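/- arXiv:2411.13656 — 2 statements merged into one kernel-verified Lean document; each statement's English description precedes it below -/
import Mathlib

section
/- Let k ≥ 1 be an integer, let G be a graph of minimum degree at least 3, and let τ be a k-tangle in G. Suppose G admits an RC-decomposition with sun Z which has length at least 18k and adhesion ℓ such that ℓ + |Z| ≥ 1. Then there exists an edge e of G such that τ extends to a k-tangle τ' in G − e. -/
open Finset

variable {V : Type} [Fintype V] [DecidableEq V]

/-- `{A, B}` is a separation of the graph `G`: the two sides together cover the vertex set and
no edge of `G` joins `A \ B` to `B \ A`. -/
def IsSep (G : SimpleGraph V) (A B : Finset V) : Prop :=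
  A ∪ B = Finset.univ ∧ ∀ a ∈ A \ B, ∀ b ∈ B \ A, ¬ G.Adj a b

/-- `G[A₁] ∪ G[A₂] ∪ G[A₃] = G` for the induced subgraphs on `A₁`, `A₂`, `A₃`. -/
def CoversG (G : SimpleGraph V) (A₁ A₂ A₃ : Finset V) : Prop :=
  (∀ v : V, v ∈ A₁ ∨ v ∈ A₂ ∨ v ∈ A₃) ∧
    ∀ u v : V, G.Adj u v →
      (u ∈ A₁ ∧ v ∈ A₁) ∨ (u ∈ A₂ ∧ v ∈ A₂) ∨ (u ∈ A₃ ∧ v ∈ A₃)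

/-- `τ` is a `k`-tangle in `G`: a set of oriented separations of order `< k` containing exactly
one orientation of every separation of order `< k`, and no three of its elements have small
sides whose induced subgraphs together cover `G`. -/
def IsTangle (G : SimpleGraph V) (k : ℕ) (τ : Set (Finset V × Finset V)) : Prop :=
  (∀ p ∈ τ, IsSep G p.1 p.2 ∧ (p.1 ∩ p.2).card < k) ∧
    (∀ A B : Finset V, IsSep G A B → (A ∩ B).card < k → ((A, B) ∈ τ ↔ (B, A) ∉ τ)) ∧
    ∀ p₁ ∈ τ, ∀ p₂ ∈ τ, ∀ p₃ ∈ τ, ¬ CoversG G p₁.1 p₂.1 p₃.1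

/-- There is a `U`–`U'` linkage of cardinality `ℓ` in the induced subgraph of `G` on `s`:
`ℓ` pairwise disjoint paths, each with all its vertices in `s`, meeting `U` exactly in one
endvertex and `U'` exactly in the other endvertex. -/
def ExistsLinkage (G : SimpleGraph V) (s U U' : Finset V) (ℓ : ℕ) : Prop :=
  ∃ (a b : Fin ℓ → V) (P : ∀ i, G.Walk (a i) (b i)),
    (∀ i, (P i).IsPath) ∧
    (∀ i, ∀ x ∈ (P i).support, x ∈ s) ∧
    (∀ i, a i ∈ U ∧ b i ∈ U') ∧
    (∀ i, ∀ x ∈ (P i).support, (x ∈ U ↔ x = a i) ∧ (x ∈ U' ↔ x = b i)) ∧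
    (∀ i j, i ≠ j → ∀ x ∈ (P i).support, x ∉ (P j).support)

/-- `W` is a linear decomposition of length `M` and adhesion `ℓ` of the induced subgraph of
`G` on the vertex set `r`. -/
structure IsLinDecomp (G : SimpleGraph V) (r : Finset V) (M ℓ : ℕ)
    (W : ℕ → Finset V) : Prop where
  subset_r : ∀ i ≤ M, W i ⊆ r
  coverV : ∀ x ∈ r, ∃ i ≤ M, x ∈ W i
  coverE : ∀ x ∈ r, ∀ y ∈ r, G.Adj x y → ∃ i ≤ M, x ∈ W i ∧ y ∈ W i
  nested : ∀ i j h : ℕ, i ≤ j → j ≤ h → h ≤ M → W i ∩ W h ⊆ W j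
  adhesion : ∀ i, 1 ≤ i → i ≤ M → (W (i - 1) ∩ W i).card = ℓ
  ne_left : ∀ i, 1 ≤ i → i ≤ M → W (i - 1) ∩ W i ≠ W (i - 1)
  ne_right : ∀ i, 1 ≤ i → i ≤ M → W (i - 1) ∩ W i ≠ W i

/-- `W` is a rainbow-decomposition of length `M` and adhesion `ℓ` of the induced subgraph of
`G` on the vertex set `r`. -/
structure IsRainbowDecomp (G : SimpleGraph V) (r : Finset V) (M ℓ : ℕ)
    (W : ℕ → Finset V) extends IsLinDecomp G r M ℓ W : Prop where
  r1 : ∀ i, 1 ≤ i → i + 1 ≤ M →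
    ExistsLinkage G (W i) (W (i - 1) ∩ W i) (W i ∩ W (i + 1)) ℓ
  r2 : ∀ i ≤ M, (G.induce (W i : Set V)).Connected
  r3 : ∀ i, 1 ≤ i → i + 1 ≤ M → Disjoint (W (i - 1) ∩ W i) (W i ∩ W (i + 1))

/-- `(R, W, Z, C)` (given by the vertex sets `r`, `z`, `c` of the rainbow `R`, the sun `Z` and
the cloud `C`, together with the bags `W`) is an RC-decomposition of `G` of length `M` and
adhesion `ℓ`. -/
structure IsRCDecomp (G : SimpleGraph V) (r z c : Finset V) (M ℓ : ℕ)
    (W : ℕ → Finset V) : Prop where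
  rainbow : IsRainbowDecomp G r M ℓ W
  sun_sub_cloud : z ⊆ c
  sun_disj_rainbow : Disjoint z r
  cover_v : ∀ x : V, x ∈ r ∪ z ∪ c
  cover_e : ∀ x y : V, G.Adj x y → (x ∈ r ∪ z ∧ y ∈ r ∪ z) ∨ (x ∈ c ∧ y ∈ c)
  rc1 : r ∩ c = (c ∩ W 0) ∪ (c ∩ W M)
  rc2_card : (c ∩ W 0).card = ℓ ∧ (c ∩ W M).card = ℓ
  rc2_disj : Disjoint (c ∩ W 0) (W 0 ∩ W 1) ∧ Disjoint (W (M - 1) ∩ W M) (c ∩ W M)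
  rc3 : ExistsLinkage G (W 0) (c ∩ W 0) (W 0 ∩ W 1) ℓ ∧
    ExistsLinkage G (W M) (W (M - 1) ∩ W M) (c ∩ W M) ℓ
  rc4 : ∀ i ≤ M, ∀ x ∈ z, ∃ y ∈ W i, G.Adj x y

set_option linter.unusedSectionVars false

/-- Two vertices are equal or adjacent. -/
def AdjEq (G : SimpleGraph V) (x y : V) : Prop := x = y ∨ G.Adj x y

lemma AdjEq.symm {G : SimpleGraph V} {x y : V} (h : AdjEq G x y) : AdjEq G y x :=
  h.imp Eq.symm fun h => h.symm

lemma isSep_iff {G : SimpleGraph V} {A B : Finset V} :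
    IsSep G A B ↔ ∀ x y, AdjEq G x y → (x ∈ A ∧ y ∈ A) ∨ (x ∈ B ∧ y ∈ B) := by
  constructor
  · rintro ⟨h1, h2⟩ x y hxy
    have hc : ∀ v, v ∈ A ∨ v ∈ B := fun v => by
      have : v ∈ A ∪ B := by rw [h1]; exact mem_univ v
      simpa using this
    rcases hxy with rfl | hxy
    · simpa using hc x
    · have hx := hc x
      have hy := hc y
      have e1 := h2 x
      have e2 := h2 y
      simp only [mem_sdiff] at e1 e2
      by_contra hcon
      by_cases hxA : x ∈ A
      · exact e1 ⟨hxA, by tauto⟩ y ⟨by tauto, by tauto⟩ hxy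
      · exact e2 ⟨by tauto, by tauto⟩ x ⟨by tauto, by tauto⟩ hxy.symm
  · intro h
    refine ⟨?_, ?_⟩
    · ext v
      have := h v v (Or.inl rfl)
      simp only [mem_union, mem_univ, iff_true]
      tauto
    · intro a ha b hb hab
      have := h a b (Or.inr hab)
      simp only [mem_sdiff] at ha hb
      tauto

lemma IsSep.symm {G : SimpleGraph V} {A B : Finset V} (h : IsSep G A B) : IsSep G B A := by
  rw [isSep_iff] at h ⊢
  exact fun x y hxy => (h x y hxy).symm

lemma coversG_iff {G : SimpleGraph V} {A B C : Finset V} :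
    CoversG G A B C ↔ ∀ x y, AdjEq G x y →
      (x ∈ A ∧ y ∈ A) ∨ (x ∈ B ∧ y ∈ B) ∨ (x ∈ C ∧ y ∈ C) := by
  constructor
  · rintro ⟨h1, h2⟩ x y (rfl | hxy)
    · simpa using h1 x
    · exact h2 x y hxy
  · exact fun h => ⟨fun v => by simpa using h v v (Or.inl rfl), fun u v huv => h u v (Or.inr huv)⟩

/-- The union of the bags with index strictly between `p` and `q`. -/
def between (W : ℕ → Finset V) (p q : ℕ) : Finset V := (Finset.Ioo p q).biUnion W

/-- The vertices lying only in bags with index strictly between `p` and `q`. -/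
def inside (W : ℕ → Finset V) (p q : ℕ) : Finset V := between W p q \ (W p ∪ W q)

/-- The bag `W p` is contained in `A \ B`. -/
def Side (W : ℕ → Finset V) (p : ℕ) (A B : Finset V) : Prop := ∀ x ∈ W p, x ∈ A ∧ x ∉ B

/-- The bag `W p` lies on one side of every separation of `H` whose separator it avoids, and
every vertex of `z` has a neighbour in it. -/
def Solid (H : SimpleGraph V) (z : Finset V) (W : ℕ → Finset V) (p : ℕ) : Prop :=
  (∀ A B, IsSep H A B → Disjoint (A ∩ B) (W p) → Side W p A B ∨ Side W p B A) ∧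
    ∀ x ∈ z, ∃ y ∈ W p, H.Adj x y

/-- Every bag `W (i + 1)` contains an `H`-linkage between its two adhesion sets. -/
def Linked (H : SimpleGraph V) (M ℓ : ℕ) (W : ℕ → Finset V) : Prop :=
  ∀ i, i + 2 ≤ M → ExistsLinkage H (W (i + 1)) (W i ∩ W (i + 1)) (W (i + 1) ∩ W (i + 2)) ℓ

/-- The properties of the bags of an RC-decomposition that do not involve the cloud. -/
structure IsBand (G : SimpleGraph V) (z : Finset V) (M ℓ : ℕ) (W : ℕ → Finset V) : Prop where
  nested : ∀ i j h x, i ≤ j → j ≤ h → h ≤ M → x ∈ W i → x ∈ W h → x ∈ W j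
  two : ∀ i j x, i + 2 ≤ j → j ≤ M → x ∈ W i → x ∉ W j
  nbr : ∀ p q x y, q ≤ M → x ∈ inside W p q → AdjEq G x y → y ∈ between W p q ∨ y ∈ z
  card : ∀ i, i < M → (W i ∩ W (i + 1)).card = ℓ
  conn : ∀ i ≤ M, (G.induce (W i : Set V)).Connected
  sun : ∀ i ≤ M, ∀ x ∈ z, ∃ y ∈ W i, G.Adj x y
  sun_disj : ∀ i ≤ M, ∀ x ∈ z, x ∉ W i
  linked : Linked G M ℓ W

lemma mem_between {W : ℕ → Finset V} {p q : ℕ} {x : V} :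
    x ∈ between W p q ↔ ∃ i, p < i ∧ i < q ∧ x ∈ W i := by
  simp [between, and_assoc]

lemma mem_inside {W : ℕ → Finset V} {p q : ℕ} {x : V} :
    x ∈ inside W p q ↔ x ∈ between W p q ∧ x ∉ W p ∧ x ∉ W q := by
  simp [inside]

lemma IsRCDecomp.isBand {G : SimpleGraph V} {r z c : Finset V} {M ℓ : ℕ} {W : ℕ → Finset V}
    (h : IsRCDecomp G r z c M ℓ W) : IsBand G z M ℓ W := by
  have hR := h.rainbow
  have nested : ∀ i j h x, i ≤ j → j ≤ h → h ≤ M → x ∈ W i → x ∈ W h → x ∈ W j :=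
    fun i j h x hij hjh hhM hi hh => hR.nested i j h hij hjh hhM (mem_inter.2 ⟨hi, hh⟩)
  have sun_disj : ∀ i ≤ M, ∀ x ∈ z, x ∉ W i := fun i hi x hx hxi =>
    Finset.disjoint_left.1 h.sun_disj_rainbow hx (hR.subset_r i hi hxi)
  refine ⟨nested, ?_, ?_, ?_, hR.r2, h.rc4, sun_disj, ?_⟩
  · intro i j x hij hjM hi hj
    have h1 := nested i (i + 1) j x (by omega) (by omega) hjM hi hj
    have h2 := nested i (i + 2) j x (by omega) (by omega) hjM hi hj
    have := hR.r3 (i + 1) (by omega) (by omega)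
    rw [Finset.disjoint_left] at this
    exact this (mem_inter.2 ⟨by simpa using hi, h1⟩) (mem_inter.2 ⟨h1, h2⟩)
  · intro p q x y hqM hx hxy
    rw [mem_inside] at hx
    obtain ⟨hxb, hxp, hxq⟩ := hx
    rcases hxy with rfl | hxy
    · exact Or.inl hxb
    obtain ⟨i, hpi, hiq, hxi⟩ := mem_between.1 hxb
    have hxr : x ∈ r := hR.subset_r i (by omega) hxi
    have loc : ∀ j ≤ M, x ∈ W j → p < j ∧ j < q := by
      intro j hj hxj
      refine ⟨?_, ?_⟩
      · by_contra hcon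
        exact hxp (nested j p i x (by omega) (by omega) (by omega) hxj hxi)
      · by_contra hcon
        exact hxq (nested i q j x (by omega) (by omega) (by omega) hxi hxj)
    have hxc : x ∉ c := by
      intro hxc
      have : x ∈ r ∩ c := mem_inter.2 ⟨hxr, hxc⟩
      rw [h.rc1] at this
      simp only [mem_union, mem_inter] at this
      rcases this with ⟨-, h0⟩ | ⟨-, h0⟩
      · have := loc 0 (by omega) h0; omega
      · have := loc M le_rfl h0; omega
    rcases h.cover_e x y hxy with ⟨-, hy⟩ | ⟨hc, -⟩
    · rcases mem_union.1 hy with hy | hy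
      · obtain ⟨j, hj, hxj, hyj⟩ := hR.coverE x hxr y hy hxy
        exact Or.inl (mem_between.2 ⟨j, (loc j hj hxj).1, (loc j hj hxj).2, hyj⟩)
      · exact Or.inr hy
    · exact absurd hc hxc
  · intro i hi
    simpa using hR.adhesion (i + 1) (by omega) (by omega)
  · intro i hi
    simpa using hR.r1 (i + 1) (by omega) (by omega)

lemma IsBand.solid {G H : SimpleGraph V} {z : Finset V} {M ℓ : ℕ} {W : ℕ → Finset V}
    (h : IsBand G z M ℓ W) {p : ℕ} (hp : p ≤ M)
    (hH : ∀ x ∈ W p, ∀ y, G.Adj x y → H.Adj x y) : Solid H z W p := by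
  constructor
  · intro A B hAB hd
    have hne : ∀ x ∈ W p, x ∈ A → x ∉ B := fun x hx hA hB =>
      Finset.disjoint_left.1 hd (mem_inter.2 ⟨hA, hB⟩) hx
    have hcov : ∀ x, x ∈ A ∨ x ∈ B := fun x => by
      have := isSep_iff.1 hAB x x (Or.inl rfl); tauto
    have hstep : ∀ x ∈ W p, ∀ y ∈ W p, G.Adj x y → x ∈ A → y ∈ A := by
      intro x hx y hy hxy hxA
      have := isSep_iff.1 hAB x y (Or.inr (hH x hx y hxy))
      have := hne x hx hxA
      tauto
    have hall : ∀ u v : (W p : Set V), (u : V) ∈ A → (v : V) ∈ A := by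
      intro u v hu
      obtain ⟨w⟩ := (h.conn p hp).preconnected u v
      induction w with
      | nil => exact hu
      | @cons a b c hab _ ih =>
        exact ih (hstep a (by simp) b (by simp) (by simpa using hab) hu)
    by_cases hex : ∃ x ∈ W p, x ∈ A
    · obtain ⟨x, hx, hxA⟩ := hex
      left
      intro y hy
      have hyA := hall ⟨x, by simpa using hx⟩ ⟨y, by simpa using hy⟩ hxA
      exact ⟨hyA, hne y hy hyA⟩
    · right
      intro y hy
      have hyA : y ∉ A := fun hA => hex ⟨y, hy, hA⟩
      exact ⟨(hcov y).resolve_left hyA, hyA⟩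
  · intro x hx
    obtain ⟨y, hy, hxy⟩ := h.sun p hp x hx
    exact ⟨y, hy, (hH y hy x hxy.symm).symm⟩

/-- The sun is on the side of every solid bag. -/
lemma Solid.sun_subset {H : SimpleGraph V} {z : Finset V} {W : ℕ → Finset V} {p : ℕ}
    {A B : Finset V} (h : Solid H z W p) (hAB : IsSep H A B) (hs : Side W p A B) :
    ∀ x ∈ z, x ∈ A := by
  intro x hx
  obtain ⟨y, hy, hxy⟩ := h.2 x hx
  have := isSep_iff.1 hAB x y (Or.inr hxy)
  have := hs y hy
  tauto

lemma IsBand.inside_mono {G : SimpleGraph V} {z : Finset V} {M ℓ : ℕ} {W : ℕ → Finset V}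
    (h : IsBand G z M ℓ W) {p q p' q' : ℕ} {x : V} (hp : p' ≤ p) (hq : q ≤ q') (hM : q' ≤ M)
    (hx : x ∈ inside W p q) : x ∈ inside W p' q' := by
  rw [mem_inside, mem_between] at hx ⊢
  obtain ⟨⟨i, hi, hi', hxi⟩, hxp, hxq⟩ := hx
  refine ⟨⟨i, by omega, by omega, hxi⟩, fun h' => hxp ?_, fun h' => hxq ?_⟩
  · exact h.nested p' p i x (by omega) (by omega) (by omega) h' hxi
  · exact h.nested i q q' x (by omega) (by omega) (by omega) hxi h'

lemma IsBand.not_mem_inside {G : SimpleGraph V} {z : Finset V} {M ℓ : ℕ} {W : ℕ → Finset V}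
    (h : IsBand G z M ℓ W) {p q i : ℕ} {x : V} (hi : i ≤ p ∨ q ≤ i) (hM : i ≤ M) (hq : q ≤ M)
    (hx : x ∈ W i) : x ∉ inside W p q := by
  rw [mem_inside, mem_between]
  rintro ⟨⟨j, hj, hj', hxj⟩, hxp, hxq⟩
  rcases hi with hi | hi
  · exact hxp (h.nested i p j x hi (by omega) (by omega) hx hxj)
  · exact hxq (h.nested j q i x (by omega) hi hM hxj hx)

/-- Few vertices cannot meet many bags. -/
lemma IsBand.exists_disjoint {G : SimpleGraph V} {z : Finset V} {M ℓ : ℕ} {W : ℕ → Finset V}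
    (h : IsBand G z M ℓ W) (X : Finset V) (T : Finset ℕ) (hT : ∀ i ∈ T, i ≤ M)
    (hc : 2 * X.card < T.card) : ∃ i ∈ T, Disjoint X (W i) := by
  by_contra hcon
  push Not at hcon
  have : ∀ i : ℕ, ∃ x, i ∈ T → x ∈ X ∧ x ∈ W i := by
    intro i
    by_cases hi : i ∈ T
    · obtain ⟨x, hx, hx'⟩ := Finset.not_disjoint_iff.1 (hcon i hi)
      exact ⟨x, fun _ => ⟨hx, hx'⟩⟩
    · have : Nonempty V := by
        obtain ⟨j, hj⟩ : T.Nonempty := Finset.card_pos.1 (by omega)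
        obtain ⟨x, -, -⟩ := Finset.not_disjoint_iff.1 (hcon j hj)
        exact ⟨x⟩
      exact ⟨Classical.arbitrary V, fun h' => absurd h' hi⟩
  choose f hf using this
  have hle : T.card ≤ 2 * X.card := by
    refine Finset.card_le_mul_card_image_of_maps_to (f := f) (fun i hi => (hf i hi).1) 2 ?_
    intro x _
    by_contra hgt
    obtain ⟨a, ha, b, hb, d, hd, hab, had, hbd⟩ := Finset.two_lt_card.1 (not_le.1 hgt)
    simp only [mem_filter] at ha hb hd
    have key : ∀ i j, i ∈ T ∧ f i = x → j ∈ T ∧ f j = x → ¬ i + 2 ≤ j := by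
      intro i j hi hj hij
      have hi' := (hf i hi.1).2
      have hj' := (hf j hj.1).2
      rw [hi.2] at hi'
      rw [hj.2] at hj'
      exact h.two i j x hij (hT j hj.1) hi' hj'
    have := key a b ha hb
    have := key b a hb ha
    have := key a d ha hd
    have := key d a hd ha
    have := key b d hb hd
    have := key d b hd hb
    omega
  omega

lemma exists_mem_support_inter {H : SimpleGraph V} {A B : Finset V} (hAB : IsSep H A B)
    {u v : V} (w : H.Walk u v) (hu : u ∈ B) (hv : v ∈ A) : ∃ x ∈ w.support, x ∈ A ∩ B := by
  induction w with
  | nil => exact ⟨_, by simp, mem_inter.2 ⟨hv, hu⟩⟩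
  | @cons a b c hab w ih =>
    by_cases hb : b ∈ B
    · obtain ⟨x, hx, hx'⟩ := ih hb hv
      exact ⟨x, by simp [hx], hx'⟩
    · refine ⟨a, by simp, mem_inter.2 ⟨?_, hu⟩⟩
      have := isSep_iff.1 hAB a b (Or.inr hab)
      tauto

lemma ExistsLinkage.reverse {H : SimpleGraph V} {s U U' : Finset V} {ℓ : ℕ}
    (h : ExistsLinkage H s U U' ℓ) : ExistsLinkage H s U' U ℓ := by
  obtain ⟨a, b, P, h1, h2, h3, h4, h5⟩ := h
  refine ⟨b, a, fun i => (P i).reverse, fun i => (h1 i).reverse, ?_, fun i => (h3 i).symm, ?_, ?_⟩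
  · intro i x hx
    exact h2 i x (by simpa using hx)
  · intro i x hx
    exact (h4 i x (by simpa using hx)).symm
  · intro i j hij x hx
    have := h5 i j hij x (by simpa using hx)
    simpa using this

/-- Across a linkage, the vertices of `U` strictly on the `B`-side continue to vertices of `U'`
strictly on that side or meet the separator outside of `U`. -/
lemma ExistsLinkage.card_le {H : SimpleGraph V} {s U U' : Finset V} {ℓ : ℕ}
    (h : ExistsLinkage H s U U' ℓ) (hU : U.card = ℓ) {A B : Finset V} (hAB : IsSep H A B) :
    (U ∩ (B \ A)).card ≤ (U' ∩ (B \ A)).card + ((A ∩ B) ∩ (s \ U)).card := by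
  obtain ⟨a, b, P, -, h2, h3, h4, h5⟩ := h
  have hinj : Function.Injective a := by
    intro i j hij
    by_contra hne
    exact h5 i j hne (a i) (by simp) (by rw [hij]; simp)
  have himg : Finset.univ.image a = U := by
    refine Finset.eq_of_subset_of_card_le ?_ ?_
    · intro x hx
      obtain ⟨i, -, rfl⟩ := mem_image.1 hx
      exact (h3 i).1
    · rw [Finset.card_image_of_injective _ hinj, hU]; simp
  have hidx : ∀ x ∈ U, ∃ i, a i = x := by
    intro x hx
    rw [← himg] at hx
    simpa using hx
  have hkey : ∀ x, ∃ y, x ∈ U ∩ (B \ A) →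
      y ∈ (U' ∩ (B \ A)) ∪ ((A ∩ B) ∩ (s \ U)) ∧ ∃ i, a i = x ∧ y ∈ (P i).support := by
    intro x
    by_cases hx : x ∈ U ∩ (B \ A)
    · simp only [mem_inter, mem_sdiff] at hx
      obtain ⟨i, rfl⟩ := hidx x hx.1
      by_cases hb : b i ∈ A
      · obtain ⟨y, hy, hyX⟩ := exists_mem_support_inter hAB (P i) hx.2.1 hb
        refine ⟨y, fun _ => ⟨?_, i, rfl, hy⟩⟩
        have hyU : y ∉ U := by
          intro hyU
          rw [(h4 i y hy).1.1 hyU] at hyX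
          exact hx.2.2 (mem_inter.1 hyX).1
        simp only [mem_union, mem_inter, mem_sdiff] at hyX ⊢
        exact Or.inr ⟨hyX, h2 i y hy, hyU⟩
      · refine ⟨b i, fun _ => ⟨?_, i, rfl, by simp⟩⟩
        have := isSep_iff.1 hAB (b i) (b i) (Or.inl rfl)
        simp only [mem_union, mem_inter, mem_sdiff]
        exact Or.inl ⟨(h3 i).2, by tauto, hb⟩
    · exact ⟨x, fun h => absurd h hx⟩
  choose f hf using hkey
  refine le_trans (Finset.card_le_card_of_injOn f (fun x hx => (hf x hx).1) ?_)
    (Finset.card_union_le _ _)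
  intro x hx y hy hxy
  obtain ⟨i, hi, hi'⟩ := (hf x hx).2
  obtain ⟨j, hj, hj'⟩ := (hf y hy).2
  rw [hxy] at hi'
  by_contra hne
  exact h5 i j (fun h => hne (by rw [← hi, ← hj, h])) _ hi' hj'

lemma IsBand.flow_left {G H : SimpleGraph V} {z : Finset V} {M ℓ : ℕ} {W : ℕ → Finset V}
    (h : IsBand G z M ℓ W) (hl : Linked H M ℓ W) {A B : Finset V} (hAB : IsSep H A B) {p : ℕ}
    (hp : Side W p A B) (j : ℕ) (hpj : p ≤ j) (hj : j + 1 ≤ M) :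
    ((W j ∩ W (j + 1)) ∩ (B \ A)).card ≤
      ((A ∩ B) ∩ (between W p (j + 1) \ W (j + 1))).card := by
  induction j, hpj using Nat.le_induction with
  | base =>
    have : (W p ∩ W (p + 1)) ∩ (B \ A) = ∅ := by
      ext x
      have := hp x
      simp only [mem_inter, mem_sdiff, Finset.notMem_empty]
      tauto
    simp [this]
  | succ j hpj ih =>
    have h1 := (hl j (by omega)).reverse.card_le (h.card (j + 1) (by omega)) hAB
    have h2 := ih (by omega)
    refine (h1.trans (Nat.add_le_add_right h2 _)).trans ?_
    rw [← Finset.card_union_of_disjoint]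
    · refine Finset.card_le_card ?_
      intro x
      simp only [mem_union, mem_inter, mem_sdiff, mem_between]
      rintro (⟨hX, ⟨i, hi, hi', hx⟩, hx'⟩ | ⟨hX, hx, hx'⟩)
      · exact ⟨hX, ⟨i, hi, by omega, hx⟩, fun hx2 =>
          hx' (h.nested i (j + 1) (j + 2) x (by omega) (by omega) (by omega) hx hx2)⟩
      · exact ⟨hX, ⟨j + 1, by omega, by omega, hx⟩, fun hx2 => hx' ⟨hx, hx2⟩⟩
    · rw [Finset.disjoint_left]
      intro x
      simp only [mem_inter, mem_sdiff]
      tauto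

lemma IsBand.flow_right {G H : SimpleGraph V} {z : Finset V} {M ℓ : ℕ} {W : ℕ → Finset V}
    (h : IsBand G z M ℓ W) (hl : Linked H M ℓ W) {A B : Finset V} (hAB : IsSep H A B) {q : ℕ}
    (hq : Side W q A B) (hqM : q ≤ M) (j : ℕ) (hj : j + 1 ≤ q) :
    ((W j ∩ W (j + 1)) ∩ (B \ A)).card ≤ ((A ∩ B) ∩ (between W j q \ W j)).card := by
  obtain ⟨q, rfl⟩ : ∃ q', q = q' + 1 := ⟨q - 1, by omega⟩
  obtain ⟨d, hd⟩ : ∃ d, j + d = q := ⟨q - j, by omega⟩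
  induction d generalizing j with
  | zero =>
    obtain rfl : j = q := hd
    have : (W j ∩ W (j + 1)) ∩ (B \ A) = ∅ := by
      ext x
      have := hq x
      simp only [mem_inter, mem_sdiff, Finset.notMem_empty]
      tauto
    simp [this]
  | succ d ih =>
    have ih := ih (j + 1) (by omega) (by omega)
    have h1 := (hl j (by omega)).card_le (h.card j (by omega)) hAB
    refine (h1.trans (Nat.add_le_add_right ih _)).trans ?_
    rw [← Finset.card_union_of_disjoint]
    · refine Finset.card_le_card ?_
      intro x
      simp only [mem_union, mem_inter, mem_sdiff, mem_between]
      rintro (⟨hX, ⟨i, hi, hi', hx⟩, hx'⟩ | ⟨hX, hx, hx'⟩)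
      · exact ⟨hX, ⟨i, by omega, hi', hx⟩, fun hx2 =>
          hx' (h.nested j (j + 1) i x (by omega) (by omega) (by omega) hx2 hx)⟩
      · exact ⟨hX, ⟨j + 1, by omega, by omega, hx⟩, fun hx2 => hx' ⟨hx2, hx⟩⟩
    · rw [Finset.disjoint_left]
      intro x
      simp only [mem_inter, mem_sdiff]
      tauto

/-- A separation that separates two bags has at least `ℓ` separator vertices between them. -/
lemma IsBand.le_card_inside {G H : SimpleGraph V} {z : Finset V} {M ℓ : ℕ} {W : ℕ → Finset V}
    (h : IsBand G z M ℓ W) (hl : Linked H M ℓ W) {A B : Finset V} (hAB : IsSep H A B) {p q : ℕ}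
    (hp : Side W p B A) (hq : Side W q A B) (hpq : p < q) (hqM : q ≤ M) :
    ℓ ≤ ((A ∩ B) ∩ inside W p q).card := by
  have h1 := h.flow_right hl hAB hq hqM p hpq
  have h2 : (W p ∩ W (p + 1)) ∩ (B \ A) = W p ∩ W (p + 1) := by
    ext x
    have := hp x
    simp only [mem_inter, mem_sdiff]
    tauto
  rw [h2, h.card p (by omega)] at h1
  refine h1.trans (Finset.card_le_card ?_)
  intro x
  have := hq x
  simp only [mem_inter, mem_sdiff, mem_inside]
  tauto

/-- Moving a set `T` to the side `A` of a separation, with new separator vertices in `U`. -/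
lemma IsSep.push {G H : SimpleGraph V} {A B T U : Finset V} (hAB : IsSep H A B)
    (hG : ∀ x y, AdjEq G x y → AdjEq H x y ∨ (x ∈ A ∧ y ∈ A) ∨ (x ∈ B ∧ y ∈ B) ∨
      (x ∈ A ∪ (T ∪ U) ∧ y ∈ A ∪ (T ∪ U)))
    (hT : ∀ x y, x ∈ T → x ∈ B → AdjEq G x y → y ∈ A ∪ (T ∪ U))
    (hc : (U ∩ (B \ A)).card ≤ ((A ∩ B) ∩ T).card) :
    IsSep G (A ∪ (T ∪ U)) (B \ T) ∧ ((A ∪ (T ∪ U)) ∩ (B \ T)).card ≤ (A ∩ B).card := by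
  constructor
  · rw [isSep_iff] at hAB ⊢
    intro x y hxy
    by_cases hx : x ∈ T ∧ x ∈ B
    · exact Or.inl ⟨mem_union_right _ (mem_union_left _ hx.1), hT x y hx.1 hx.2 hxy⟩
    by_cases hy : y ∈ T ∧ y ∈ B
    · exact Or.inl ⟨hT y x hy.1 hy.2 hxy.symm, mem_union_right _ (mem_union_left _ hy.1)⟩
    have key : ∀ u v, (u ∈ A ∧ v ∈ A) ∨ (u ∈ B ∧ v ∈ B) → ¬ (u ∈ T ∧ u ∈ B) →
        ¬ (v ∈ T ∧ v ∈ B) →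
        (u ∈ A ∪ (T ∪ U) ∧ v ∈ A ∪ (T ∪ U)) ∨ (u ∈ B \ T ∧ v ∈ B \ T) := by
      rintro u v (⟨h1, h2⟩ | ⟨h1, h2⟩) hu hv
      · exact Or.inl ⟨mem_union_left _ h1, mem_union_left _ h2⟩
      · exact Or.inr ⟨mem_sdiff.2 ⟨h1, fun h => hu ⟨h, h1⟩⟩, mem_sdiff.2 ⟨h2, fun h => hv ⟨h, h2⟩⟩⟩
    rcases hG x y hxy with h | h | h | h
    · exact key x y (hAB x y h) hx hy
    · exact key x y (Or.inl h) hx hy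
    · exact key x y (Or.inr h) hx hy
    · exact Or.inl h
  · have : (A ∪ (T ∪ U)) ∩ (B \ T) ⊆ ((A ∩ B) \ T) ∪ (U ∩ (B \ A)) := by
      intro x
      simp only [mem_union, mem_sdiff, mem_inter]
      tauto
    have h1 := (Finset.card_le_card this).trans (Finset.card_union_le _ _)
    have h2 := Finset.card_sdiff_add_card_inter (A ∩ B) T
    omega

section

variable {G H : SimpleGraph V} {z : Finset V} {M ℓ k : ℕ} {W : ℕ → Finset V}
  {τ : Set (Finset V × Finset V)}

lemma IsTangle.mem_or (hτ : IsTangle G k τ) {A B : Finset V} (h : IsSep G A B)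
    (hc : (A ∩ B).card < k) : (A, B) ∈ τ ∨ (B, A) ∈ τ := by
  have := hτ.2.1 A B h hc
  tauto

lemma IsTangle.not_cover (hτ : IsTangle G k τ) {A B C A' B' C' : Finset V} (h1 : (A, A') ∈ τ)
    (h2 : (B, B') ∈ τ) (h3 : (C, C') ∈ τ)
    (h : ∀ x y, AdjEq G x y → (x ∈ A ∧ y ∈ A) ∨ (x ∈ B ∧ y ∈ B) ∨ (x ∈ C ∧ y ∈ C)) : False :=
  hτ.2.2 _ h1 _ h2 _ h3 (coversG_iff.2 h)

/-- Filling up the part between two bags on the same side of a separation. -/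
lemma IsBand.fill (h : IsBand G z M ℓ W) {A B : Finset V} (hAB : IsSep H A B) {p q : ℕ}
    (hqM : q ≤ M) (hp : Side W p A B) (hq : Side W q A B) (hz : ∀ x ∈ z, x ∈ A)
    (hG : ∀ x y, AdjEq G x y → x ∉ inside W p q → y ∉ inside W p q → AdjEq H x y) :
    IsSep G (A ∪ inside W p q) (B \ inside W p q) ∧
      ((A ∪ inside W p q) ∩ (B \ inside W p q)).card ≤ (A ∩ B).card ∧
      (∀ x ∈ between W p q, x ∈ A ∪ inside W p q) := by
  have hb : ∀ x ∈ between W p q, x ∈ A ∪ inside W p q := by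
    intro x hx
    have h1 := hp x
    have h2 := hq x
    simp only [mem_union, mem_inside]
    tauto
  have hn : ∀ x y, x ∈ inside W p q → AdjEq G x y → y ∈ A ∪ inside W p q := by
    intro x y hx hxy
    rcases h.nbr p q x y hqM hx hxy with hy | hy
    · exact hb y hy
    · exact mem_union_left _ (hz y hy)
  have := hAB.push (G := G) (T := inside W p q) (U := ∅) ?_ ?_ (by simp)
  · rw [Finset.union_empty] at this
    exact ⟨this.1, this.2, hb⟩
  · intro x y hxy
    rw [Finset.union_empty]
    by_cases hx : x ∈ inside W p q
    · exact Or.inr (Or.inr (Or.inr ⟨mem_union_right _ hx, hn x y hx hxy⟩))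
    by_cases hy : y ∈ inside W p q
    · exact Or.inr (Or.inr (Or.inr ⟨hn y x hy hxy.symm, mem_union_right _ hy⟩))
    exact Or.inl (hG x y hxy hx hy)
  · intro x y hx _ hxy
    rw [Finset.union_empty]
    exact hn x y hx hxy

lemma IsBand.isSep_local (h : IsBand G z M ℓ W) {A B : Finset V} (hAB : IsSep G A B) {p q : ℕ}
    (hqM : q ≤ M) (hp : Side W p A B) (hq : Side W q A B) (hz : ∀ x ∈ z, x ∈ A) :
    IsSep G (A ∪ (inside W p q)ᶜ) (B ∩ (between W p q ∪ z)) ∧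
      ((A ∪ (inside W p q)ᶜ) ∩ (B ∩ (between W p q ∪ z))).card ≤ (A ∩ B).card := by
  constructor
  · rw [isSep_iff] at hAB ⊢
    intro x y hxy
    replace hAB := hAB x y hxy
    have h2 := h.nbr p q x y hqM
    have h3 := h.nbr p q y x hqM
    have h4 := h.nbr p q x x hqM
    have h5 := h.nbr p q y y hqM
    have h6 := hxy.symm
    have e1 : AdjEq G x x := Or.inl rfl
    have e2 : AdjEq G y y := Or.inl rfl
    simp only [mem_union, mem_inter, mem_compl]
    by_cases hx : x ∈ inside W p q <;> by_cases hy : y ∈ inside W p q <;> simp_all <;> tauto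
  · refine Finset.card_le_card ?_
    intro x
    have h1 := hp x
    have h2 := hq x
    have h3 := hz x
    simp only [mem_union, mem_inter, mem_compl, mem_inside]
    tauto

/-- If two bags are strictly on the small side, either the part between them can be added to the
small side or the tangle points to this part. -/
lemma IsBand.fill_mem (h : IsBand G z M ℓ W) (hτ : IsTangle G k τ) {A B : Finset V}
    (hAB : (A, B) ∈ τ) {p q : ℕ} (hqM : q ≤ M) (hp : Side W p A B) (hq : Side W q A B)
    (hz : ∀ x ∈ z, x ∈ A) :
    (A ∪ inside W p q, B \ inside W p q) ∈ τ ∨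
      (A ∪ (inside W p q)ᶜ, B ∩ (between W p q ∪ z)) ∈ τ := by
  obtain ⟨hs, hc⟩ := hτ.1 _ hAB
  obtain ⟨h1, h2, -⟩ := h.fill hs hqM hp hq hz (fun _ _ h _ _ => h)
  obtain ⟨h3, h4⟩ := h.isSep_local hs hqM hp hq hz
  rcases hτ.mem_or h1 (h2.trans_lt hc) with h5 | h5
  · exact Or.inl h5
  rcases hτ.mem_or h3 (h4.trans_lt hc) with h6 | h6
  · exact Or.inr h6
  exfalso
  refine hτ.not_cover hAB h5 h6 ?_
  intro x y hxy
  have h7 := isSep_iff.1 hs x y hxy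
  have h8 := h.nbr p q x y hqM
  have h9 := h.nbr p q y x hqM
  have e := hxy.symm
  have h10 : x ∈ inside W p q → x ∈ between W p q := fun h => (mem_inside.1 h).1
  have h11 : y ∈ inside W p q → y ∈ between W p q := fun h => (mem_inside.1 h).1
  simp only [mem_union, mem_inter, mem_sdiff]
  by_cases hx : x ∈ inside W p q <;> by_cases hy : y ∈ inside W p q <;> simp_all <;> tauto

/-- The small sides of two elements of the tangle cover everything but the part of the graph
strictly between the bags `W p` and `W q`. -/
def Focused (G : SimpleGraph V) (τ : Set (Finset V × Finset V)) (W : ℕ → Finset V) (p q : ℕ) :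
    Prop :=
  ∃ A B C D, (A, B) ∈ τ ∧ (C, D) ∈ τ ∧
    (∀ x y, AdjEq G x y → x ∉ inside W p q → y ∉ inside W p q →
      (x ∈ A ∧ y ∈ A) ∨ (x ∈ C ∧ y ∈ C)) ∧
    Side W p A B ∧ (Side W q A B ∨ Side W q B A)

end

section

variable {G H : SimpleGraph V} {z : Finset V} {M ℓ k : ℕ} {W : ℕ → Finset V}
  {τ : Set (Finset V × Finset V)}

lemma IsBand.not_mem_inside_of_sun (h : IsBand G z M ℓ W) {p q : ℕ} {x : V} (hq : q ≤ M)
    (hx : x ∈ z) : x ∉ inside W p q := by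
  rw [mem_inside, mem_between]
  rintro ⟨⟨j, hj, hj', hxj⟩, -, -⟩
  exact h.sun_disj j (by omega) x hx hxj

lemma Focused.not_mem {p q : ℕ} (hf : Focused G τ W p q) (h : IsBand G z M ℓ W)
    (hτ : IsTangle G k τ) (hq : q ≤ M) {S S' : Finset V} (hb : ∀ x ∈ between W p q, x ∈ S)
    (hz : ∀ x ∈ z, x ∈ S) : (S, S') ∉ τ := by
  intro hS
  obtain ⟨A, B, C, D, hA, hC, hcov, -⟩ := hf
  refine hτ.not_cover hA hC hS ?_
  intro x y hxy
  have key : ∀ u v, AdjEq G u v → u ∈ inside W p q → u ∈ S ∧ v ∈ S := by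
    intro u v huv hu
    refine ⟨hb u (mem_inside.1 hu).1, ?_⟩
    rcases h.nbr p q u v hq hu huv with hv | hv
    · exact hb v hv
    · exact hz v hv
  by_cases hx : x ∈ inside W p q
  · exact Or.inr (Or.inr (key x y hxy hx))
  by_cases hy : y ∈ inside W p q
  · exact Or.inr (Or.inr (key y x hxy.symm hy).symm)
  rcases hcov x y hxy hx hy with h | h
  · exact Or.inl h
  · exact Or.inr (Or.inl h)

lemma IsBand.isSep_between (h : IsBand G z M ℓ W) {p q : ℕ} (hpq : p < q) (hq : q ≤ M) :
    IsSep G (between W p q ∪ z) (inside W p q)ᶜ ∧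
      ((between W p q ∪ z) ∩ (inside W p q)ᶜ).card ≤ ℓ + ℓ + z.card := by
  constructor
  · rw [isSep_iff]
    intro x y hxy
    by_cases hx : x ∈ inside W p q
    · exact Or.inl ⟨mem_union_left _ (mem_inside.1 hx).1, mem_union.2 (h.nbr p q x y hq hx hxy)⟩
    by_cases hy : y ∈ inside W p q
    · exact Or.inl ⟨mem_union.2 (h.nbr p q y x hq hy hxy.symm),
        mem_union_left _ (mem_inside.1 hy).1⟩
    exact Or.inr ⟨mem_compl.2 hx, mem_compl.2 hy⟩
  · have : (between W p q ∪ z) ∩ (inside W p q)ᶜ ⊆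
        (W p ∩ W (p + 1)) ∪ (W (q - 1) ∩ W (q - 1 + 1)) ∪ z := by
      intro x
      simp only [mem_inter, mem_union, mem_compl, mem_inside, mem_between]
      rintro ⟨⟨i, hi, hi', hx⟩ | hx, hx'⟩
      · by_cases hxp : x ∈ W p
        · exact Or.inl (Or.inl ⟨hxp, h.nested p (p + 1) i x (by omega) (by omega) (by omega) hxp hx⟩)
        · have hxq : x ∈ W q := by
            by_contra hxq
            exact hx' ⟨⟨i, hi, hi', hx⟩, hxp, hxq⟩
          refine Or.inl (Or.inr ⟨h.nested i (q - 1) q x (by omega) (by omega) hq hx hxq, ?_⟩)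
          rwa [Nat.sub_add_cancel (by omega)]
      · exact Or.inr hx
    refine (Finset.card_le_card this).trans ((Finset.card_union_le _ _).trans ?_)
    refine Nat.add_le_add_right ((Finset.card_union_le _ _).trans ?_) _
    rw [h.card p (by omega), h.card (q - 1) (by omega)]

/-- A tangle cannot be focused on two disjoint parts of the band. -/
lemma Focused.false_of_lt (h : IsBand G z M ℓ W) (hτ : IsTangle G k τ) {p₁ q₁ p₂ q₂ : ℕ}
    (f₁ : Focused G τ W p₁ q₁) (f₂ : Focused G τ W p₂ q₂) (h₁ : 2 * k ≤ p₁) (h₁₁ : p₁ < q₁)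
    (h₁₂ : q₁ < p₂) (h₂₂ : p₂ < q₂) (hM : q₂ ≤ M) : False := by
  have hsol : ∀ p ≤ M, Solid G z W p := fun p hp => h.solid hp (fun _ _ _ h => h)
  have g₂ := f₂
  obtain ⟨A, B, C, D, hA, -, -, hp, hq⟩ := g₂
  obtain ⟨hAB, hcard⟩ := hτ.1 _ hA
  simp only at hAB hcard
  have hzA := (hsol p₂ (by omega)).sun_subset hAB hp
  have hcompl : ∀ {p q p' q' : ℕ}, q ≤ M → q' ≤ M → q ≤ p' ∨ q' ≤ p →
      ∀ x ∈ between W p q, x ∈ (inside W p' q')ᶜ := by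
    intro p q p' q' hqM hqM' hd x hx
    obtain ⟨i, hi, hi', hxi⟩ := mem_between.1 hx
    exact mem_compl.2 (h.not_mem_inside (by omega) (by omega) hqM' hxi)
  have hzcompl : ∀ {p q : ℕ}, q ≤ M → ∀ x ∈ z, x ∈ (inside W p q)ᶜ := fun hqM x hx =>
    mem_compl.2 (h.not_mem_inside_of_sun hqM hx)
  have hfill : ∀ {p q : ℕ}, Side W p A B → Side W q A B →
      ∀ x ∈ between W p q, x ∈ A ∪ inside W p q := by
    intro p q hp hq x hx
    have h1 := hp x
    have h2 := hq x
    simp only [mem_union, mem_inside]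
    tauto
  rcases hq with hq | hq
  · rcases h.fill_mem hτ hA hM hp hq hzA with h1 | h1
    · exact f₂.not_mem h hτ hM (hfill hp hq) (fun x hx => mem_union_left _ (hzA x hx)) h1
    · exact f₁.not_mem h hτ (by omega)
        (fun x hx => mem_union_right _ (hcompl (by omega) hM (by omega) x hx))
        (fun x hx => mem_union_left _ (hzA x hx)) h1
  obtain ⟨s, hs, hsX⟩ := h.exists_disjoint (A ∩ B) (Finset.range (2 * k))
    (fun i hi => by have := Finset.mem_range.1 hi; omega) (by rw [Finset.card_range]; omega)
  rw [Finset.mem_range] at hs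
  rcases (hsol s (by omega)).1 A B hAB hsX with hsA | hsB
  · rcases h.fill_mem hτ hA (p := s) (q := p₂) (by omega) hsA hp hzA with h1 | h1
    · refine f₁.not_mem h hτ (by omega) (fun x hx => hfill hsA hp x ?_)
        (fun x hx => mem_union_left _ (hzA x hx)) h1
      obtain ⟨i, hi, hi', hx⟩ := mem_between.1 hx
      exact mem_between.2 ⟨i, by omega, by omega, hx⟩
    · exact f₂.not_mem h hτ hM
        (fun x hx => mem_union_right _ (hcompl hM (by omega) (by omega) x hx))
        (fun x hx => mem_union_left _ (hzA x hx)) h1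
  · have hzB := (hsol s (by omega)).sun_subset hAB.symm hsB
    have c1 := h.le_card_inside h.linked hAB hsB hp (by omega) (by omega)
    have c2 := h.le_card_inside h.linked hAB.symm hp hq h₂₂ hM
    have c3 : ((A ∩ B) ∩ inside W s p₂).card + ((B ∩ A) ∩ inside W p₂ q₂).card + z.card ≤
        (A ∩ B).card := by
      rw [← Finset.card_union_of_disjoint, ← Finset.card_union_of_disjoint]
      · refine Finset.card_le_card ?_
        intro x
        have := hzA x
        have := hzB x
        simp only [mem_union, mem_inter]
        tauto
      · rw [Finset.disjoint_left]
        intro x hx hxz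
        simp only [mem_union, mem_inter] at hx
        rcases hx with hx | hx
        · exact h.not_mem_inside_of_sun (by omega) hxz hx.2
        · exact h.not_mem_inside_of_sun hM hxz hx.2
      · rw [Finset.disjoint_left]
        intro x hx hx'
        simp only [mem_inter] at hx hx'
        exact mem_compl.1 (hcompl (by omega) hM (by omega) x (mem_inside.1 hx.2).1) hx'.2
    obtain ⟨s1, s2⟩ := h.isSep_between h₁₁ (by omega)
    rcases hτ.mem_or s1 (by omega) with h1 | h1
    · exact f₁.not_mem h hτ (by omega) (fun x hx => mem_union_left _ hx)
        (fun x hx => mem_union_right _ hx) h1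
    · exact f₂.not_mem h hτ hM (hcompl hM (by omega) (by omega)) (hzcompl (by omega)) h1

end

section

variable {G H : SimpleGraph V} {z : Finset V} {M ℓ k : ℕ} {W : ℕ → Finset V}
  {τ : Set (Finset V × Finset V)}

/-- The bag `W p` is contained in one of the strict sides of `{A, B}`. -/
def Free (W : ℕ → Finset V) (p : ℕ) (A B : Finset V) : Prop := Side W p A B ∨ Side W p B A

lemma Free.symm {p : ℕ} {A B : Finset V} (h : Free W p A B) : Free W p B A := Or.symm h

/-- The pairs `(A, B)` and `(A', B')` coincide outside the part of the band between `W p` and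
`W q`. -/
def Agrees (W : ℕ → Finset V) (p q : ℕ) (A B A' B' : Finset V) : Prop :=
  ∀ x ∉ inside W p q, (x ∈ A' ↔ x ∈ A) ∧ (x ∈ B' ↔ x ∈ B)

lemma Agrees.symm {p q : ℕ} {A B A' B' : Finset V} (h : Agrees W p q A B A' B') :
    Agrees W p q B A B' A' := fun x hx => (h x hx).symm

lemma Agrees.side {p q i : ℕ} {A B A' B' : Finset V} (h : Agrees W p q A B A' B')
    (hi : ∀ x ∈ W i, x ∉ inside W p q) (hs : Side W i A B) : Side W i A' B' := by
  intro x hx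
  have := h x (hi x hx)
  have := hs x hx
  tauto

lemma mem_push_iff {A B T U : Finset V} {x : V} (h : x ∈ T ∪ U → x ∈ A ∧ x ∉ B) :
    (x ∈ A ∪ (T ∪ U) ↔ x ∈ A) ∧ (x ∈ B \ T ↔ x ∈ B) := by
  simp only [mem_union, mem_sdiff] at h ⊢
  tauto

/-- The graph `H` arises from `G` by deleting the edge `x₀y₀` around the bag `W (m + 1)`, and the
tangle `τ` is not focused on the part of the band around this bag. -/
structure IsPruning (G H : SimpleGraph V) (z : Finset V) (M ℓ k : ℕ) (W : ℕ → Finset V)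
    (τ : Set (Finset V × Finset V)) (m : ℕ) (x₀ y₀ : V) : Prop where
  band : IsBand G z M ℓ W
  tangle : IsTangle G k τ
  pos : 1 ≤ k
  le : ∀ u v, H.Adj u v → G.Adj u v
  adj : ∀ u v, AdjEq G u v → AdjEq H u v ∨ (u = x₀ ∧ v = y₀) ∨ (u = y₀ ∧ v = x₀)
  mem : x₀ ∈ W (m + 1)
  left_notMem : ∀ p ≤ M, p < m ∨ m + 3 < p → x₀ ∉ W p
  right_notMem : ∀ p ≤ M, p < m ∨ m + 3 < p → y₀ ∉ W p
  sun_or : y₀ ∈ z ∨ x₀ ∈ W (m + 2)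
  linked : Linked H M ℓ W
  lower : 4 * k ≤ m + 2
  upper : m + 4 * k + 1 ≤ M
  not_focused : ∀ p q, m + 2 ≤ p + 4 * k → p < q → q ≤ m + 4 * k + 1 → ¬ Focused G τ W p q

namespace IsPruning

variable {m : ℕ} {x₀ y₀ : V}

lemma solid (hs : IsPruning G H z M ℓ k W τ m x₀ y₀) {p : ℕ} (hp : p ≤ M)
    (hp' : p < m ∨ m + 3 < p) : Solid H z W p := by
  refine hs.band.solid hp ?_
  intro x hx y hxy
  have h1 := hs.left_notMem p hp hp'
  have h2 := hs.right_notMem p hp hp'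
  rcases hs.adj x y (Or.inr hxy) with (h | h) | ⟨rfl, -⟩ | ⟨rfl, -⟩
  · exact absurd h hxy.ne
  · exact h
  · exact absurd hx h1
  · exact absurd hx h2

lemma mem_inside (hs : IsPruning G H z M ℓ k W τ m x₀ y₀) {p q : ℕ} (hp : p < m)
    (hq : m + 3 < q) (hM : q ≤ M) : x₀ ∈ inside W p q :=
  _root_.mem_inside.2 ⟨mem_between.2 ⟨m + 1, by omega, by omega, hs.mem⟩,
    hs.left_notMem p (by omega) (Or.inl hp), hs.left_notMem q hM (Or.inr hq)⟩

lemma adjEq (hs : IsPruning G H z M ℓ k W τ m x₀ y₀) {p q : ℕ} (hp : p < m) (hq : m + 3 < q)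
    (hM : q ≤ M) (x y : V) (hxy : AdjEq G x y) (hx : x ∉ inside W p q) (hy : y ∉ inside W p q) :
    AdjEq H x y := by
  rcases hs.adj x y hxy with h | ⟨rfl, -⟩ | ⟨-, rfl⟩
  · exact h
  · exact absurd (hs.mem_inside hp hq hM) hx
  · exact absurd (hs.mem_inside hp hq hM) hy

lemma isSep (hs : IsPruning G H z M ℓ k W τ m x₀ y₀) {A B : Finset V} (h : IsSep G A B) :
    IsSep H A B :=
  isSep_iff.2 fun x y hxy => isSep_iff.1 h x y (hxy.imp id (hs.le x y))

/-- Opposite orientations of a separation of `H` cannot both be induced by the tangle. -/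
lemma not_both (hs : IsPruning G H z M ℓ k W τ m x₀ y₀) {A B A₁ B₁ A₂ B₂ : Finset V}
    (hAB : IsSep H A B) {p₁ q₁ p₂ q₂ : ℕ} (hp₁ : m + 2 ≤ p₁ + 4 * k ∧ p₁ < m)
    (hq₁ : m + 3 < q₁ ∧ q₁ ≤ m + 4 * k + 1) (hp₂ : m + 2 ≤ p₂ + 4 * k ∧ p₂ < m)
    (hq₂ : m + 3 < q₂ ∧ q₂ ≤ m + 4 * k + 1) (fp₁ : Free W p₁ A B) (fq₁ : Free W q₁ A B)
    (fp₂ : Free W p₂ A B) (fq₂ : Free W q₂ A B) (h₁ : (A₁, B₁) ∈ τ)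
    (a₁ : Agrees W p₁ q₁ A B A₁ B₁) (h₂ : (B₂, A₂) ∈ τ) (a₂ : Agrees W p₂ q₂ A B A₂ B₂) :
    False := by
  have hup := hs.upper
  obtain ⟨p, hp, fp, hpp₁, hpp₂⟩ : ∃ p, (m + 2 ≤ p + 4 * k ∧ p < m) ∧ Free W p A B ∧ p ≤ p₁ ∧
      p ≤ p₂ := by
    rcases le_total p₁ p₂ with h | h
    · exact ⟨p₁, hp₁, fp₁, le_rfl, h⟩
    · exact ⟨p₂, hp₂, fp₂, h, le_rfl⟩
  obtain ⟨q, hq, fq, hqq₁, hqq₂⟩ : ∃ q, (m + 3 < q ∧ q ≤ m + 4 * k + 1) ∧ Free W q A B ∧ q₁ ≤ q ∧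
      q₂ ≤ q := by
    rcases le_total q₁ q₂ with h | h
    · exact ⟨q₂, hq₂, fq₂, h, le_rfl⟩
    · exact ⟨q₁, hq₁, fq₁, le_rfl, h⟩
  have hcov : ∀ x y, AdjEq G x y → x ∉ inside W p q → y ∉ inside W p q →
      (x ∈ A₁ ∧ y ∈ A₁) ∨ (x ∈ B₂ ∧ y ∈ B₂) := by
    intro x y hxy hx hy
    have hout : ∀ u, u ∉ inside W p q → u ∉ inside W p₁ q₁ ∧ u ∉ inside W p₂ q₂ := fun u hu =>
      ⟨fun h => hu (hs.band.inside_mono hpp₁ hqq₁ (by omega) h),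
        fun h => hu (hs.band.inside_mono hpp₂ hqq₂ (by omega) h)⟩
    have h1 := isSep_iff.1 hAB x y (hs.adjEq hp.2 hq.1 (by omega) x y hxy hx hy)
    have h2 := a₁ x (hout x hx).1
    have h3 := a₁ y (hout y hy).1
    have h4 := a₂ x (hout x hx).2
    have h5 := a₂ y (hout y hy).2
    rw [h2.1, h3.1, h4.2, h5.2]
    exact h1
  have ni : ∀ {i p' q'}, i ≤ p' ∨ q' ≤ i → i ≤ M → q' ≤ M → ∀ x ∈ W i, x ∉ inside W p' q' :=
    fun h1 h2 h3 x hx => hs.band.not_mem_inside h1 h2 h3 hx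
  rcases fp with fp | fp
  · refine hs.not_focused p q hp.1 (by omega) hq.2 ⟨A₁, B₁, B₂, A₂, h₁, h₂, hcov, ?_, ?_⟩
    · exact a₁.side (ni (Or.inl hpp₁) (by omega) (by omega)) fp
    · exact fq.imp (a₁.side (ni (Or.inr hqq₁) (by omega) (by omega)))
        (a₁.symm.side (ni (Or.inr hqq₁) (by omega) (by omega)))
  · refine hs.not_focused p q hp.1 (by omega) hq.2 ⟨B₂, A₂, A₁, B₁, h₂, h₁,
      fun x y h1 h2 h3 => (hcov x y h1 h2 h3).symm, ?_, ?_⟩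
    · exact a₂.symm.side (ni (Or.inl hpp₂) (by omega) (by omega)) fp
    · exact fq.symm.imp (a₂.symm.side (ni (Or.inr hqq₂) (by omega) (by omega)))
        (a₂.side (ni (Or.inr hqq₂) (by omega) (by omega)))

lemma fill (hs : IsPruning G H z M ℓ k W τ m x₀ y₀) {A B : Finset V} (hAB : IsSep H A B)
    {p q : ℕ} (hp : p < m) (hq : m + 3 < q) (hM : q ≤ M) (sp : Side W p A B)
    (sq : Side W q A B) (hz : ∀ x ∈ z, x ∈ A) :
    ∃ A' B', IsSep G A' B' ∧ (A' ∩ B').card ≤ (A ∩ B).card ∧ Agrees W p q A B A' B' ∧ A ⊆ A' ∧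
      (∀ x ∈ z, x ∈ A') ∧ ∀ i, p < i → i < q → W i ⊆ A' := by
  obtain ⟨h1, h2, h3⟩ := hs.band.fill hAB hM sp sq hz (hs.adjEq hp hq hM)
  refine ⟨_, _, h1, h2, ?_, subset_union_left, fun x hx => mem_union_left _ (hz x hx), ?_⟩
  · intro x hx
    simp [hx]
  · intro i hi hi' x hx
    exact h3 x (mem_between.2 ⟨i, hi, hi', hx⟩)

/-- A separation of `H` can be modified between a bag strictly on its small side and a later bag
to become a separation of `G`. -/
lemma exists_push_left (hs : IsPruning G H z M ℓ k W τ m x₀ y₀) {A B : Finset V}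
    (hAB : IsSep H A B) {p q : ℕ} (hp : p < m) (hq : m + 3 < q) (hM : q ≤ M)
    (sp : Side W p A B) (sq : Free W q A B) :
    ∃ A' B', IsSep G A' B' ∧ (A' ∩ B').card ≤ (A ∩ B).card ∧ Agrees W p q A B A' B' ∧ A ⊆ A' ∧
      (∀ x ∈ z, x ∈ A') ∧ ∀ i, p < i → i + 1 < q → W i ⊆ A' := by
  have hb := hs.band
  have hz := (hs.solid (by omega) (Or.inl hp)).sun_subset hAB sp
  rcases sq with sq | sq
  · obtain ⟨A', B', h1, h2, h3, h4, h5, h6⟩ := hs.fill hAB hp hq hM sp sq hz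
    exact ⟨A', B', h1, h2, h3, h4, h5, fun i hi hi' => h6 i hi (by omega)⟩
  obtain ⟨j, rfl⟩ : ∃ j, q = j + 2 := ⟨q - 2, by omega⟩
  set T := between W p (j + 1) \ W (j + 1) with hT
  set U := W j ∩ W (j + 1) with hU
  have hbet : ∀ x ∈ between W p (j + 1), x ∈ T ∪ U := by
    intro x hx
    by_cases hx' : x ∈ W (j + 1)
    · obtain ⟨i, hi, hi', hxi⟩ := mem_between.1 hx
      exact mem_union_right _ (mem_inter.2
        ⟨hb.nested i j (j + 1) x (by omega) (by omega) (by omega) hxi hx', hx'⟩)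
    · exact mem_union_left _ (mem_sdiff.2 ⟨hx, hx'⟩)
  have hnb : ∀ x y, x ∈ inside W p (j + 1) → AdjEq G x y → y ∈ A ∪ (T ∪ U) := by
    intro x y hx hxy
    rcases hb.nbr p (j + 1) x y (by omega) hx hxy with hy | hy
    · exact mem_union_right _ (hbet y hy)
    · exact mem_union_left _ (hz y hy)
  have hx₀ : x₀ ∈ inside W p (j + 1) := _root_.mem_inside.2
    ⟨mem_between.2 ⟨m + 1, by omega, by omega, hs.mem⟩, hs.left_notMem p (by omega) (Or.inl hp),
      hb.two (m + 1) (j + 1) x₀ (by omega) (by omega) hs.mem⟩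
  have hx₀' : x₀ ∈ A ∪ (T ∪ U) := hnb x₀ x₀ hx₀ (Or.inl rfl)
  obtain ⟨h1, h2⟩ := hAB.push (G := G) (T := T) (U := U) (by
      intro x y hxy
      rcases hs.adj x y hxy with h | ⟨rfl, rfl⟩ | ⟨rfl, rfl⟩
      · exact Or.inl h
      · exact Or.inr (Or.inr (Or.inr ⟨hx₀', hnb _ _ hx₀ hxy⟩))
      · exact Or.inr (Or.inr (Or.inr ⟨hnb _ _ hx₀ hxy.symm, hx₀'⟩))) (by
      intro x y hx hxB hxy
      have := mem_sdiff.1 hx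
      exact hnb x y (_root_.mem_inside.2 ⟨this.1, fun h => (sp x h).2 hxB, this.2⟩) hxy)
    (hb.flow_left hs.linked hAB sp j (by omega) (by omega))
  refine ⟨_, _, h1, h2, ?_, subset_union_left, fun x hx => mem_union_left _ (hz x hx), ?_⟩
  · intro x hx
    have key : x ∈ T ∪ U → x ∈ W p := by
      intro hxTU
      by_contra hxp
      obtain ⟨i, hi, hi', hxi⟩ : ∃ i, p < i ∧ i < j + 1 ∧ x ∈ W i := by
        rcases mem_union.1 hxTU with h | h
        · exact mem_between.1 (mem_sdiff.1 h).1
        · exact ⟨j, by omega, by omega, (mem_inter.1 h).1⟩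
      exact hx (_root_.mem_inside.2 ⟨mem_between.2 ⟨i, hi, by omega, hxi⟩, hxp,
        hb.two i (j + 2) x (by omega) hM hxi⟩)
    exact mem_push_iff fun h => sp x (key h)
  · intro i hi hi' x hx
    exact mem_union_right _ (hbet x (mem_between.2 ⟨i, hi, by omega, hx⟩))

/-- A separation of `H` can be modified between a bag strictly on its small side and an earlier
bag to become a separation of `G`. -/
lemma exists_push_right (hs : IsPruning G H z M ℓ k W τ m x₀ y₀) {A B : Finset V}
    (hAB : IsSep H A B) {p q : ℕ} (hp : p < m) (hq : m + 3 < q) (hM : q ≤ M)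
    (sp : Free W p A B) (sq : Side W q A B) :
    ∃ A' B', IsSep G A' B' ∧ (A' ∩ B').card ≤ (A ∩ B).card ∧ Agrees W p q A B A' B' ∧ A ⊆ A' ∧
      (∀ x ∈ z, x ∈ A') ∧ ∀ i, p + 1 < i → i < q → W i ⊆ A' := by
  have hb := hs.band
  have hz := (hs.solid hM (Or.inr hq)).sun_subset hAB sq
  rcases sp with sp | sp
  · obtain ⟨A', B', h1, h2, h3, h4, h5, h6⟩ := hs.fill hAB hp hq hM sp sq hz
    exact ⟨A', B', h1, h2, h3, h4, h5, fun i hi hi' => h6 i (by omega) hi'⟩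
  set T := between W (p + 1) q \ W (p + 1) with hT
  set U := W (p + 1) ∩ W (p + 1 + 1) with hU
  have hbet : ∀ x ∈ between W (p + 1) q, x ∈ T ∪ U := by
    intro x hx
    by_cases hx' : x ∈ W (p + 1)
    · obtain ⟨i, hi, hi', hxi⟩ := mem_between.1 hx
      exact mem_union_right _ (mem_inter.2
        ⟨hx', hb.nested (p + 1) (p + 1 + 1) i x (by omega) (by omega) (by omega) hx' hxi⟩)
    · exact mem_union_left _ (mem_sdiff.2 ⟨hx, hx'⟩)
  have hnb : ∀ x y, x ∈ inside W (p + 1) q → AdjEq G x y → y ∈ A ∪ (T ∪ U) := by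
    intro x y hx hxy
    rcases hb.nbr (p + 1) q x y hM hx hxy with hy | hy
    · exact mem_union_right _ (hbet y hy)
    · exact mem_union_left _ (hz y hy)
  have hx₀b : x₀ ∈ between W (p + 1) q := mem_between.2 ⟨m + 1, by omega, by omega, hs.mem⟩
  have hx₀' : x₀ ∈ A ∪ (T ∪ U) := mem_union_right _ (hbet x₀ hx₀b)
  have hy₀ : AdjEq G x₀ y₀ → y₀ ∈ A ∪ (T ∪ U) := by
    intro hxy
    rcases hs.sun_or with h | h
    · exact mem_union_left _ (hz _ h)
    · refine hnb x₀ y₀ (_root_.mem_inside.2 ⟨hx₀b, fun h' => ?_,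
        hs.left_notMem q hM (Or.inr hq)⟩) hxy
      exact hb.two (p + 1) (m + 2) x₀ (by omega) (by omega) h' h
  obtain ⟨h1, h2⟩ := hAB.push (G := G) (T := T) (U := U) (by
      intro x y hxy
      rcases hs.adj x y hxy with h | ⟨rfl, rfl⟩ | ⟨rfl, rfl⟩
      · exact Or.inl h
      · exact Or.inr (Or.inr (Or.inr ⟨hx₀', hy₀ hxy⟩))
      · exact Or.inr (Or.inr (Or.inr ⟨hy₀ hxy.symm, hx₀'⟩))) (by
      intro x y hx hxB hxy
      have := mem_sdiff.1 hx
      exact hnb x y (_root_.mem_inside.2 ⟨this.1, this.2, fun h => (sq x h).2 hxB⟩) hxy)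
    (hb.flow_right hs.linked hAB sq hM (p + 1) (by omega))
  refine ⟨_, _, h1, h2, ?_, subset_union_left, fun x hx => mem_union_left _ (hz x hx), ?_⟩
  · intro x hx
    have key : x ∈ T ∪ U → x ∈ W q := by
      intro hxTU
      by_contra hxq
      obtain ⟨i, hi, hi', hxi⟩ : ∃ i, p + 1 < i ∧ i < q ∧ x ∈ W i := by
        rcases mem_union.1 hxTU with h | h
        · exact mem_between.1 (mem_sdiff.1 h).1
        · exact ⟨p + 1 + 1, by omega, by omega, (mem_inter.1 h).2⟩
      exact hx (_root_.mem_inside.2 ⟨mem_between.2 ⟨i, by omega, by omega, hxi⟩,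
        fun h => hb.two p i x (by omega) (by omega) h hxi, hxq⟩)
    exact mem_push_iff fun h => sq x (key h)
  · intro i hi hi' x hx
    exact mem_union_right _ (hbet x (mem_between.2 ⟨i, hi, hi', hx⟩))

end IsPruning

end

section

variable {G H : SimpleGraph V} {z : Finset V} {M ℓ k : ℕ} {W : ℕ → Finset V}
  {τ : Set (Finset V × Finset V)}

/-- The orientation of the separations of `H` induced by a tangle `τ` of `G`: the separations are
compared outside of a part of the band around `W m` whose two boundary bags avoid the separator. -/
def induced (H : SimpleGraph V) (k : ℕ) (W : ℕ → Finset V) (τ : Set (Finset V × Finset V))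
    (m : ℕ) : Set (Finset V × Finset V) :=
  {s | IsSep H s.1 s.2 ∧ (s.1 ∩ s.2).card < k ∧ ∃ p q, (m + 2 ≤ p + 4 * k ∧ p < m) ∧
    (m + 3 < q ∧ q ≤ m + 4 * k + 1) ∧ Free W p s.1 s.2 ∧ Free W q s.1 s.2 ∧
    ∃ A' B', (A', B') ∈ τ ∧ Agrees W p q s.1 s.2 A' B'}

namespace IsPruning

variable {m : ℕ} {x₀ y₀ : V}

lemma free (hs : IsPruning G H z M ℓ k W τ m x₀ y₀) {A B : Finset V} (hAB : IsSep H A B) {p : ℕ}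
    (hp : p ≤ M) (hp' : p < m ∨ m + 3 < p) (hd : Disjoint (A ∩ B) (W p)) : Free W p A B :=
  (hs.solid hp hp').1 A B hAB hd

lemma exists_free (hs : IsPruning G H z M ℓ k W τ m x₀ y₀) {A B : Finset V} (hAB : IsSep H A B)
    (hc : (A ∩ B).card < k) (u v : ℕ) (huv : u + 2 * k ≤ v + 1) (hv : v ≤ M + 1)
    (h : ∀ i, u ≤ i → i < v → i < m ∨ m + 3 < i) : ∃ i, u ≤ i ∧ i < v ∧ Free W i A B := by
  obtain ⟨i, hi, hd⟩ := hs.band.exists_disjoint (A ∩ B) (Finset.Ico u v)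
    (fun i hi => by have := Finset.mem_Ico.1 hi; omega) (by rw [Nat.card_Ico]; omega)
  rw [Finset.mem_Ico] at hi
  exact ⟨i, hi.1, hi.2, hs.free hAB (by omega) (h i hi.1 hi.2) hd⟩

lemma exists_extension (hs : IsPruning G H z M ℓ k W τ m x₀ y₀) {A B : Finset V}
    (hAB : IsSep H A B) {p q : ℕ} (hp : p < m) (hq : m + 3 < q) (hM : q ≤ M)
    (sp : Free W p A B) (sq : Free W q A B) :
    ∃ A' B', IsSep G A' B' ∧ (A' ∩ B').card ≤ (A ∩ B).card ∧ Agrees W p q A B A' B' := by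
  rcases sp with sp | sp
  · obtain ⟨A', B', h1, h2, h3, -⟩ := hs.exists_push_left hAB hp hq hM sp sq
    exact ⟨A', B', h1, h2, h3⟩
  · obtain ⟨A', B', h1, h2, h3, -⟩ := hs.exists_push_left hAB.symm hp hq hM sp sq.symm
    exact ⟨B', A', h1.symm, by rwa [inter_comm B' A', inter_comm A B], h3.symm⟩

lemma not_mem_induced (hs : IsPruning G H z M ℓ k W τ m x₀ y₀) {A B : Finset V}
    (h : (A, B) ∈ induced H k W τ m) : (B, A) ∉ induced H k W τ m := by
  intro h'
  obtain ⟨h1, -, p, q, hp, hq, fp, fq, A', B', hA, ha⟩ := h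
  obtain ⟨-, -, p', q', hp', hq', fp', fq', A'', B'', hA', ha'⟩ := h'
  exact hs.not_both h1 hp hq hp' hq' fp fq fp'.symm fq'.symm hA ha hA' ha'.symm

/-- A modification of an element of the induced orientation belongs to the tangle. -/
lemma mem_of_agrees (hs : IsPruning G H z M ℓ k W τ m x₀ y₀) {A B : Finset V}
    (h : (A, B) ∈ induced H k W τ m) {p q : ℕ} (hp : m + 2 ≤ p + 4 * k ∧ p < m)
    (hq : m + 3 < q ∧ q ≤ m + 4 * k + 1) (fp : Free W p A B) (fq : Free W q A B)
    {A' B' : Finset V} (hA' : IsSep G A' B') (hc : (A' ∩ B').card ≤ (A ∩ B).card)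
    (ha : Agrees W p q A B A' B') : (A', B') ∈ τ := by
  rcases hs.tangle.mem_or hA' (hc.trans_lt h.2.1) with h1 | h1
  · exact h1
  · exact absurd ⟨h.1.symm, by rw [inter_comm]; exact h.2.1, p, q, hp, hq, fp.symm, fq.symm, B', A',
      h1, ha.symm⟩ (hs.not_mem_induced h)

lemma mem_induced_or (hs : IsPruning G H z M ℓ k W τ m x₀ y₀) {A B : Finset V}
    (hAB : IsSep H A B) (hc : (A ∩ B).card < k) :
    (A, B) ∈ induced H k W τ m ∨ (B, A) ∈ induced H k W τ m := by
  have hlo := hs.lower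
  have hup := hs.upper
  have hk := hs.pos
  obtain ⟨p, hp, hp', fp⟩ := hs.exists_free hAB hc (m + 2 - 4 * k) m (by omega) (by omega)
    (fun i h1 h2 => by omega)
  obtain ⟨q, hq, hq', fq⟩ := hs.exists_free hAB hc (m + 4) (m + 4 * k + 2) (by omega) (by omega)
    (fun i h1 h2 => by omega)
  obtain ⟨A', B', h1, h2, h3⟩ := hs.exists_extension hAB hp' (by omega) (by omega) fp fq
  rcases hs.tangle.mem_or h1 (h2.trans_lt hc) with h | h
  · exact Or.inl ⟨hAB, hc, p, q, by omega, by omega, fp, fq, A', B', h, h3⟩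
  · exact Or.inr ⟨hAB.symm, by rwa [inter_comm], p, q, by omega, by omega, fp.symm, fq.symm, B', A',
      h, h3.symm⟩

lemma subset_induced (hs : IsPruning G H z M ℓ k W τ m x₀ y₀) :
    τ ⊆ induced H k W τ m := by
  rintro ⟨A, B⟩ h
  have hlo := hs.lower
  have hup := hs.upper
  have hk := hs.pos
  obtain ⟨h1, hc⟩ := hs.tangle.1 _ h
  have hAB := hs.isSep h1
  obtain ⟨p, hp, hp', fp⟩ := hs.exists_free hAB hc (m + 2 - 4 * k) m (by omega) (by omega)
    (fun i h1 h2 => by omega)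
  obtain ⟨q, hq, hq', fq⟩ := hs.exists_free hAB hc (m + 4) (m + 4 * k + 2) (by omega) (by omega)
    (fun i h1 h2 => by omega)
  exact ⟨hAB, hc, p, q, by omega, by omega, fp, fq, A, B, h, fun x _ => ⟨Iff.rfl, Iff.rfl⟩⟩

lemma not_cover_of_between (hs : IsPruning G H z M ℓ k W τ m x₀ y₀) {A₁ A₁' B₁' A₂ B₂ A₃ B₃ :
    Finset V} (hA₁ : (A₁', B₁') ∈ τ) (hsub : A₁ ⊆ A₁') (hz : ∀ x ∈ z, x ∈ A₁')
    (hA₂ : (A₂, B₂) ∈ induced H k W τ m) (hA₃ : (A₃, B₃) ∈ induced H k W τ m)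
    {p₂ q₂ p₃ q₃ : ℕ} (hp₂ : m + 2 ≤ p₂ + 4 * k ∧ p₂ < m)
    (hq₂ : m + 3 < q₂ ∧ q₂ ≤ m + 4 * k + 1) (hp₃ : m + 2 ≤ p₃ + 4 * k ∧ p₃ < m)
    (hq₃ : m + 3 < q₃ ∧ q₃ ≤ m + 4 * k + 1) (fp₂ : Free W p₂ A₂ B₂) (fq₂ : Free W q₂ A₂ B₂)
    (fp₃ : Free W p₃ A₃ B₃) (fq₃ : Free W q₃ A₃ B₃) (hb₂ : ∀ i, p₂ < i → i < q₂ → W i ⊆ A₁')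
    (hb₃ : ∀ i, p₃ < i → i < q₃ → W i ⊆ A₁') : ¬ CoversG H A₁ A₂ A₃ := by
  intro hcov
  have hup := hs.upper
  obtain ⟨A₂', B₂', s2, c2, a2⟩ := hs.exists_extension hA₂.1 hp₂.2 hq₂.1 (by omega) fp₂ fq₂
  obtain ⟨A₃', B₃', s3, c3, a3⟩ := hs.exists_extension hA₃.1 hp₃.2 hq₃.1 (by omega) fp₃ fq₃
  have m2 := hs.mem_of_agrees hA₂ hp₂ hq₂ fp₂ fq₂ s2 c2 a2
  have m3 := hs.mem_of_agrees hA₃ hp₃ hq₃ fp₃ fq₃ s3 c3 a3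
  refine hs.tangle.not_cover hA₁ m2 m3 ?_
  have key : ∀ {p q : ℕ}, q ≤ M → (∀ i, p < i → i < q → W i ⊆ A₁') → ∀ x y, AdjEq G x y →
      x ∈ inside W p q → x ∈ A₁' ∧ y ∈ A₁' := by
    intro p q hq hb x y hxy hx
    have hb' : ∀ u ∈ between W p q, u ∈ A₁' := by
      intro u hu
      obtain ⟨i, hi, hi', hu⟩ := mem_between.1 hu
      exact hb i hi hi' hu
    refine ⟨hb' x (_root_.mem_inside.1 hx).1, ?_⟩
    rcases hs.band.nbr p q x y hq hx hxy with h | h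
    · exact hb' y h
    · exact hz y h
  intro x y hxy
  by_cases hx2 : x ∈ inside W p₂ q₂
  · exact Or.inl (key (by omega) hb₂ x y hxy hx2)
  by_cases hy2 : y ∈ inside W p₂ q₂
  · exact Or.inl (key (by omega) hb₂ y x hxy.symm hy2).symm
  by_cases hx3 : x ∈ inside W p₃ q₃
  · exact Or.inl (key (by omega) hb₃ x y hxy hx3)
  by_cases hy3 : y ∈ inside W p₃ q₃
  · exact Or.inl (key (by omega) hb₃ y x hxy.symm hy3).symm
  rcases coversG_iff.1 hcov x y (hs.adjEq hp₂.2 hq₂.1 (by omega) x y hxy hx2 hy2) with h | h | h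
  · exact Or.inl ⟨hsub h.1, hsub h.2⟩
  · exact Or.inr (Or.inl ⟨(a2 x hx2).1.2 h.1, (a2 y hy2).1.2 h.2⟩)
  · exact Or.inr (Or.inr ⟨(a3 x hx3).1.2 h.1, (a3 y hy3).1.2 h.2⟩)

lemma not_cover_of_side (hs : IsPruning G H z M ℓ k W τ m x₀ y₀) {A₁ B₁ A₂ B₂ A₃ B₃ : Finset V}
    (hA₁ : (A₁, B₁) ∈ induced H k W τ m) (hA₂ : (A₂, B₂) ∈ induced H k W τ m)
    (hA₃ : (A₃, B₃) ∈ induced H k W τ m) {s : ℕ} (hs₁ : m + 2 ≤ s + 4 * k)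
    (hs₂ : s ≤ m + 4 * k + 1) (hs₃ : s < m ∨ m + 3 < s) (f₁ : Side W s A₁ B₁)
    (f₂ : Free W s A₂ B₂) (f₃ : Free W s A₃ B₃) : ¬ CoversG H A₁ A₂ A₃ := by
  have hlo := hs.lower
  have hup := hs.upper
  have hk := hs.pos
  rcases hs₃ with hs₃ | hs₃
  · obtain ⟨q₁, hq₁, hq₁', g₁⟩ := hs.exists_free hA₁.1 hA₁.2.1 (m + 2 * k + 3) (m + 4 * k + 2)
      (by omega) (by omega) (fun i h1 h2 => by omega)
    obtain ⟨q₂, hq₂, hq₂', g₂⟩ := hs.exists_free hA₂.1 hA₂.2.1 (m + 4) (m + 2 * k + 3)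
      (by omega) (by omega) (fun i h1 h2 => by omega)
    obtain ⟨q₃, hq₃, hq₃', g₃⟩ := hs.exists_free hA₃.1 hA₃.2.1 (m + 4) (m + 2 * k + 3)
      (by omega) (by omega) (fun i h1 h2 => by omega)
    obtain ⟨A', B', h1, h2, h3, h4, h5, h6⟩ :=
      hs.exists_push_left hA₁.1 (p := s) (q := q₁) hs₃ (by omega) (by omega) f₁ g₁
    have hA' := hs.mem_of_agrees hA₁ (by omega) (by omega) (Or.inl f₁) g₁ h1 h2 h3
    exact hs.not_cover_of_between hA' h4 h5 hA₂ hA₃ (by omega) (by omega) (by omega) (by omega)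
      f₂ g₂ f₃ g₃ (fun i hi hi' => h6 i hi (by omega)) (fun i hi hi' => h6 i hi (by omega))
  · obtain ⟨p₁, hp₁, hp₁', g₁⟩ := hs.exists_free hA₁.1 hA₁.2.1 (m + 2 - 4 * k) (m + 1 - 2 * k)
      (by omega) (by omega) (fun i h1 h2 => by omega)
    obtain ⟨p₂, hp₂, hp₂', g₂⟩ := hs.exists_free hA₂.1 hA₂.2.1 (m + 1 - 2 * k) m
      (by omega) (by omega) (fun i h1 h2 => by omega)
    obtain ⟨p₃, hp₃, hp₃', g₃⟩ := hs.exists_free hA₃.1 hA₃.2.1 (m + 1 - 2 * k) m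
      (by omega) (by omega) (fun i h1 h2 => by omega)
    obtain ⟨A', B', h1, h2, h3, h4, h5, h6⟩ :=
      hs.exists_push_right hA₁.1 (p := p₁) (q := s) (by omega) hs₃ (by omega) g₁ f₁
    have hA' := hs.mem_of_agrees hA₁ (by omega) (by omega) g₁ (Or.inl f₁) h1 h2 h3
    exact hs.not_cover_of_between hA' h4 h5 hA₂ hA₃ (by omega) (by omega) (by omega) (by omega)
      g₂ f₂ g₃ f₃ (fun i hi hi' => h6 i (by omega) hi') (fun i hi hi' => h6 i (by omega) hi')

/-- The induced orientation is a tangle of the pruned graph. -/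
theorem isTangle_induced (hs : IsPruning G H z M ℓ k W τ m x₀ y₀) :
    IsTangle H k (induced H k W τ m) := by
  have hlo := hs.lower
  have hup := hs.upper
  have hk := hs.pos
  refine ⟨fun s h => ⟨h.1, h.2.1⟩, fun A B hAB hc => ⟨hs.not_mem_induced, fun h =>
    (hs.mem_induced_or hAB hc).resolve_right h⟩, ?_⟩
  rintro ⟨A₁, B₁⟩ h₁ ⟨A₂, B₂⟩ h₂ ⟨A₃, B₃⟩ h₃ hcov
  have hcov' := coversG_iff.1 hcov
  simp only at hcov hcov'
  have c₁ : (A₁ ∩ B₁).card < k := h₁.2.1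
  have c₂ : (A₂ ∩ B₂).card < k := h₂.2.1
  have c₃ : (A₃ ∩ B₃).card < k := h₃.2.1
  obtain ⟨s, hsT, hd⟩ := hs.band.exists_disjoint (A₁ ∩ B₁ ∪ A₂ ∩ B₂ ∪ A₃ ∩ B₃)
    (Finset.Ico (m + 2 - 4 * k) m ∪ Finset.Ico (m + 4) (m + 4 * k + 2))
    (fun i hi => by
      simp only [mem_union, Finset.mem_Ico] at hi
      omega) (by
      have e1 := Finset.card_union_le (A₁ ∩ B₁ ∪ A₂ ∩ B₂) (A₃ ∩ B₃)
      have e2 := Finset.card_union_le (A₁ ∩ B₁) (A₂ ∩ B₂)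
      have e3 : Disjoint (Finset.Ico (m + 2 - 4 * k) m)
          (Finset.Ico (m + 4) (m + 4 * k + 2)) := by
        rw [Finset.disjoint_left]
        intro i
        simp only [Finset.mem_Ico]
        omega
      rw [Finset.card_union_of_disjoint e3, Nat.card_Ico, Nat.card_Ico]
      omega)
  simp only [mem_union, Finset.mem_Ico] at hsT
  rw [Finset.disjoint_union_left, Finset.disjoint_union_left] at hd
  have hs' : s < m ∨ m + 3 < s := by omega
  have f₁ := hs.free h₁.1 (by omega) hs' hd.1.1
  have f₂ := hs.free h₂.1 (by omega) hs' hd.1.2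
  have f₃ := hs.free h₃.1 (by omega) hs' hd.2
  obtain ⟨⟨x, hx⟩⟩ : Nonempty (W s : Set V) := (hs.band.conn s (by omega)).nonempty
  have hxs : x ∈ W s := by simpa using hx
  have side : ∀ {A B : Finset V}, Free W s A B → x ∈ A → Side W s A B := by
    intro A B hf hxA
    exact hf.resolve_right fun h => (h x hxs).2 hxA
  rcases hcov' x x (Or.inl rfl) with h | h | h
  · exact hs.not_cover_of_side h₁ h₂ h₃ (by omega) (by omega) hs' (side f₁ h.1) f₂ f₃ hcov
  · refine hs.not_cover_of_side h₂ h₁ h₃ (by omega) (by omega) hs' (side f₂ h.1) f₁ f₃ ?_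
    exact coversG_iff.2 fun u v huv => by have := hcov' u v huv; tauto
  · refine hs.not_cover_of_side h₃ h₁ h₂ (by omega) (by omega) hs' (side f₃ h.1) f₁ f₂ ?_
    exact coversG_iff.2 fun u v huv => by have := hcov' u v huv; tauto

end IsPruning

end

section

variable {G H : SimpleGraph V} {z : Finset V} {M ℓ k : ℕ} {W : ℕ → Finset V}
  {τ : Set (Finset V × Finset V)}

lemma exists_linkage_deleteEdges {s U U' : Finset V} {a b : Fin ℓ → V}
    {P : ∀ i, G.Walk (a i) (b i)} (h₁ : ∀ i, (P i).IsPath) (h₂ : ∀ i, ∀ x ∈ (P i).support, x ∈ s)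
    (h₃ : ∀ i, a i ∈ U ∧ b i ∈ U')
    (h₄ : ∀ i, ∀ x ∈ (P i).support, (x ∈ U ↔ x = a i) ∧ (x ∈ U' ↔ x = b i))
    (h₅ : ∀ i j, i ≠ j → ∀ x ∈ (P i).support, x ∉ (P j).support) {e : Sym2 V}
    (he : ∀ i, e ∉ (P i).edges) : ExistsLinkage (G.deleteEdges {e}) s U U' ℓ := by
  have ht : ∀ i, ∀ f ∈ (P i).edges, f ∈ (G.deleteEdges {e}).edgeSet := by
    intro i f hf
    rw [SimpleGraph.edgeSet_deleteEdges]
    refine ⟨(P i).edges_subset_edgeSet hf, ?_⟩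
    rintro rfl
    exact he i hf
  refine ⟨a, b, fun i => (P i).transfer _ (ht i), fun i => (h₁ i).transfer _, ?_, h₃, ?_, ?_⟩
  · simpa using h₂
  · simpa using h₄
  · simpa using h₅

lemma ExistsLinkage.deleteEdges_of_notMem {s U U' : Finset V} (h : ExistsLinkage G s U U' ℓ)
    {x y : V} (hxy : x ∉ s ∨ y ∉ s) : ExistsLinkage (G.deleteEdges {s(x, y)}) s U U' ℓ := by
  obtain ⟨a, b, P, h1, h2, h3, h4, h5⟩ := h
  refine exists_linkage_deleteEdges h1 h2 h3 h4 h5 fun i he => ?_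
  rcases hxy with hx | hy
  · exact hx (h2 i x ((P i).fst_mem_support_of_mem_edges he))
  · exact hy (h2 i y ((P i).snd_mem_support_of_mem_edges he))

/-- A linkage uses at most one edge at a given vertex of its starting set. -/
lemma ExistsLinkage.exists_deleteEdges {s U U' : Finset V} (h : ExistsLinkage G s U U' ℓ) {x : V}
    (hx : x ∈ U) : ∃ v, ∀ y, y ≠ v → ExistsLinkage (G.deleteEdges {s(x, y)}) s U U' ℓ := by
  obtain ⟨a, b, P, h1, h2, h3, h4, h5⟩ := h
  by_cases hex : ∃ i, x ∈ (P i).support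
  · obtain ⟨i, hi⟩ := hex
    refine ⟨(P i).snd, fun y hy => exists_linkage_deleteEdges h1 h2 h3 h4 h5 fun j he => ?_⟩
    have hj := (P j).fst_mem_support_of_mem_edges he
    obtain rfl : i = j := by
      by_contra hne
      exact h5 i j hne x hi hj
    obtain rfl := (h4 i x hi).1.1 hx
    exact hy ((h1 i).eq_snd_of_mem_edges he)
  · refine ⟨x, fun y _ => exists_linkage_deleteEdges h1 h2 h3 h4 h5 fun j he => ?_⟩
    exact hex ⟨j, (P j).fst_mem_support_of_mem_edges he⟩

lemma exists_adj_ne_ne {x : V} (hdeg : 3 ≤ (G.neighborSet x).ncard) (v w : V) :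
    ∃ y, G.Adj x y ∧ y ≠ v ∧ y ≠ w := by
  have h : ({v, w} : Set V).ncard < (G.neighborSet x).ncard :=
    (Set.ncard_insert_le v {w}).trans_lt (by rw [Set.ncard_singleton]; omega)
  obtain ⟨y, hy, hy'⟩ := Set.exists_mem_notMem_of_ncard_lt_ncard h
  simp only [Set.mem_insert_iff, Set.mem_singleton_iff, not_or] at hy'
  exact ⟨y, hy, hy'⟩

lemma adjEq_deleteEdges {x₀ y₀ u v : V} (h : AdjEq G u v) :
    AdjEq (G.deleteEdges {s(x₀, y₀)}) u v ∨ (u = x₀ ∧ v = y₀) ∨ (u = y₀ ∧ v = x₀) := by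
  by_cases he : s(u, v) = s(x₀, y₀)
  · rw [Sym2.eq_iff] at he
    exact Or.inr he
  · refine Or.inl (h.imp id fun h => ?_)
    rw [SimpleGraph.deleteEdges_adj]
    exact ⟨h, he⟩

/-- Around every bag `W (m + 1)` there is an edge whose deletion preserves the linkages. -/
lemma IsBand.exists_edge (h : IsBand G z M ℓ W) (hdeg : ∀ v, 3 ≤ (G.neighborSet v).ncard)
    (hℓz : 1 ≤ ℓ + z.card) {m : ℕ} (hm : m + 3 ≤ M) : ∃ x y, G.Adj x y ∧ x ∈ W (m + 1) ∧
      (∀ p ≤ M, p < m ∨ m + 3 < p → y ∉ W p) ∧ (y ∈ z ∨ x ∈ W (m + 2)) ∧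
      Linked (G.deleteEdges {s(x, y)}) M ℓ W := by
  by_cases hz : z.Nonempty
  · obtain ⟨y, hy⟩ := hz
    obtain ⟨x, hx, hyx⟩ := h.sun (m + 1) (by omega) y hy
    exact ⟨x, y, hyx.symm, hx, fun p hp _ => h.sun_disj p hp y hy, Or.inl hy, fun i hi =>
      (h.linked i hi).deleteEdges_of_notMem (Or.inr (h.sun_disj (i + 1) (by omega) y hy))⟩
  · rw [Finset.not_nonempty_iff_eq_empty] at hz
    subst hz
    have hc := h.card (m + 1) (by omega)
    obtain ⟨x, hx⟩ : (W (m + 1) ∩ W (m + 1 + 1)).Nonempty := by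
      rw [← Finset.card_pos, hc]
      simpa [Nat.succ_le_iff] using hℓz
    obtain ⟨v, hv⟩ := (h.linked m (by omega)).reverse.exists_deleteEdges hx
    obtain ⟨w, hw⟩ := (h.linked (m + 1) (by omega)).exists_deleteEdges hx
    obtain ⟨y, hxy, hyv, hyw⟩ := exists_adj_ne_ne (hdeg x) v w
    rw [mem_inter] at hx
    have hlo : ∀ p, p ≤ m → x ∉ W p := fun p hp hxp =>
      h.two p (m + 2) x (by omega) (by omega) hxp hx.2
    have hhi : ∀ p, m + 3 ≤ p → p ≤ M → x ∉ W p := fun p hp hpM =>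
      h.two (m + 1) p x (by omega) hpM hx.1
    refine ⟨x, y, hxy, hx.1, ?_, Or.inr hx.2, ?_⟩
    · intro p hp hp' hyp
      have hxi : x ∈ inside W m (m + 3) := mem_inside.2
        ⟨mem_between.2 ⟨m + 1, by omega, by omega, hx.1⟩, hlo m le_rfl, hhi _ le_rfl hm⟩
      rcases h.nbr m (m + 3) x y hm hxi (Or.inr hxy) with hy | hy
      · obtain ⟨i, hi, hi', hyi⟩ := mem_between.1 hy
        rcases hp' with hp' | hp'
        · exact h.two p i y (by omega) (by omega) hyp hyi
        · exact h.two i p y (by omega) hp hyi hyp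
      · exact absurd hy (Finset.notMem_empty y)
    · intro i hi
      rcases lt_trichotomy i m with him | rfl | him
      · exact (h.linked i hi).deleteEdges_of_notMem (Or.inl (hlo _ (by omega)))
      · exact (hv y hyv).reverse
      · rcases (Nat.succ_le_iff.2 him).eq_or_lt with him' | him'
        · obtain rfl : m + 1 = i := him'
          exact hw y hyw
        · exact (h.linked i hi).deleteEdges_of_notMem (Or.inl (hhi _ (by omega) (by omega)))

lemma IsBand.exists_tangle_deleteEdges (h : IsBand G z M ℓ W) (hτ : IsTangle G k τ) (hk : 1 ≤ k)
    (hdeg : ∀ v, 3 ≤ (G.neighborSet v).ncard) (hℓz : 1 ≤ ℓ + z.card) {m : ℕ}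
    (hlo : 4 * k ≤ m + 2) (hup : m + 4 * k + 1 ≤ M)
    (hf : ∀ p q, m + 2 ≤ p + 4 * k → p < q → q ≤ m + 4 * k + 1 → ¬ Focused G τ W p q) :
    ∃ e ∈ G.edgeSet, ∃ τ' : Set (Finset V × Finset V),
      IsTangle (G.deleteEdges {e}) k τ' ∧ τ ⊆ τ' := by
  obtain ⟨x, y, hxy, hx, hy, hyz, hl⟩ := h.exists_edge hdeg hℓz (m := m) (by omega)
  have hs : IsPruning G (G.deleteEdges {s(x, y)}) z M ℓ k W τ m x y :=
    { band := h
      tangle := hτ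
      pos := hk
      le := fun u v huv => (SimpleGraph.deleteEdges_adj.1 huv).1
      adj := fun u v huv => adjEq_deleteEdges huv
      mem := hx
      left_notMem := fun p hp hp' hxp => by
        rcases hp' with hp' | hp'
        · exact h.two p (m + 1) x (by omega) (by omega) hxp hx
        · exact h.two (m + 1) p x (by omega) hp hx hxp
      right_notMem := hy
      sun_or := hyz
      linked := hl
      lower := hlo
      upper := hup
      not_focused := hf }
  exact ⟨s(x, y), hxy, _, hs.isTangle_induced, hs.subset_induced⟩

end
/-- Let `k ≥ 1`, let `G` be a graph of minimum degree at least 3, and let `τ` be a `k`-tangle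
in `G`.  If `G` admits an RC-decomposition with sun `Z` of length at least `18k` and adhesion
`ℓ` with `ℓ + |Z| ≥ 1`, then there is an edge `e` of `G` such that `τ` extends to a `k`-tangle
in `G - e`. -/
theorem stmt18 (k : ℕ) (hk : 1 ≤ k) (G : SimpleGraph V)
    (hdeg : ∀ v : V, 3 ≤ (G.neighborSet v).ncard)
    (τ : Set (Finset V × Finset V)) (hτ : IsTangle G k τ)
    (M ℓ : ℕ) (r z c : Finset V) (W : ℕ → Finset V)
    (hM : 18 * k ≤ M) (hrc : IsRCDecomp G r z c M ℓ W) (hℓz : 1 ≤ ℓ + z.card) :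
    ∃ e ∈ G.edgeSet, ∃ τ' : Set (Finset V × Finset V),
      IsTangle (G.deleteEdges {e}) k τ' ∧ τ ⊆ τ' := by
  have h := hrc.isBand
  by_cases hf : ∃ p q, 2 * k ≤ p ∧ p < q ∧ q < 10 * k ∧ Focused G τ W p q
  · obtain ⟨p, q, hp, hpq, hq, hf⟩ := hf
    refine h.exists_tangle_deleteEdges hτ hk hdeg hℓz (m := 14 * k - 2) (by omega) (by omega) ?_
    intro p' q' hp' hpq' hq' hf'
    exact hf.false_of_lt h hτ hf' hp hpq (by omega) hpq' (by omega)
  · refine h.exists_tangle_deleteEdges hτ hk hdeg hℓz (m := 6 * k - 2) (by omega) (by omega) ?_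
    intro p q hp hpq hq hf'
    exact hf ⟨p, q, by omega, hpq, by omega, hf'⟩
end

section
/- For every integer k ≥ 1 there exists an integer M' = M'(k) such that every k-tangle in any graph G is witnessed by some subgraph H of G with at most M' vertices and at most M' edges. -/
open Finset

variable {V : Type} [Fintype V] [DecidableEq V]

/-- The subgraph `H` of `G` witnesses that `τ` is a tangle: for every three (not necessarily
distinct) elements of `τ`, `H` is not a subgraph of the union of the induced subgraphs on
their small sides. -/
def Witnesses (G : SimpleGraph V) (H : G.Subgraph)
    (τ : Set (Finset V × Finset V)) : Prop :=
  ∀ p₁ ∈ τ, ∀ p₂ ∈ τ, ∀ p₃ ∈ τ,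
    ¬ ((∀ v ∈ H.verts, v ∈ p₁.1 ∨ v ∈ p₂.1 ∨ v ∈ p₃.1) ∧
        ∀ u v : V, H.Adj u v →
          (u ∈ p₁.1 ∧ v ∈ p₁.1) ∨ (u ∈ p₂.1 ∧ v ∈ p₂.1) ∨ (u ∈ p₃.1 ∧ v ∈ p₃.1))

/-- The induced subgraphs on the two sides of a separation contain every edge. -/
lemma IsSep.adj_mem {G : SimpleGraph V} {A B : Finset V} (h : IsSep G A B) {u v : V}
    (huv : G.Adj u v) : (u ∈ A ∧ v ∈ A) ∨ (u ∈ B ∧ v ∈ B) := by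
  have hu : u ∈ A ∪ B := h.1 ▸ Finset.mem_univ u
  have hv : v ∈ A ∪ B := h.1 ▸ Finset.mem_univ v
  have h₁ := h.2 u
  have h₂ := h.2 v
  have h₃ := huv.symm
  simp only [Finset.mem_union, Finset.mem_sdiff] at *
  grind

lemma IsSep.of_adj_mem {G : SimpleGraph V} {A B : Finset V} (hcov : ∀ v, v ∈ A ∨ v ∈ B)
    (hadj : ∀ u v, G.Adj u v → (u ∈ A ∧ v ∈ A) ∨ (u ∈ B ∧ v ∈ B)) : IsSep G A B := by
  refine ⟨by ext v; simpa using hcov v, fun a ha b hb hab => ?_⟩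
  have := hadj a b hab
  simp only [Finset.mem_sdiff] at ha hb
  tauto

lemma IsSep.mem_or_mem {G : SimpleGraph V} {A B : Finset V} (h : IsSep G A B) (v : V) :
    v ∈ A ∨ v ∈ B := by
  have hv : v ∈ A ∪ B := h.1 ▸ Finset.mem_univ v
  simpa using hv

lemma IsSep.inter_union {G : SimpleGraph V} {A B A' B' : Finset V} (h : IsSep G A B)
    (h' : IsSep G A' B') : IsSep G (A ∩ A') (B ∪ B') := by
  refine .of_adj_mem (fun v => ?_) fun u v huv => ?_
  · have := h.mem_or_mem v
    have := h'.mem_or_mem v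
    simp only [Finset.mem_inter, Finset.mem_union]
    tauto
  · have := h.adj_mem huv
    have := h'.adj_mem huv
    simp only [Finset.mem_inter, Finset.mem_union]
    tauto

lemma IsSep.union_inter {G : SimpleGraph V} {A B A' B' : Finset V} (h : IsSep G A B)
    (h' : IsSep G A' B') : IsSep G (A ∪ A') (B ∩ B') :=
  (h.symm.inter_union h'.symm).symm

/-- The order of separations is submodular. -/
lemma card_inter_union_add_card_union_inter_le {W : Type*} [DecidableEq W]
    (A B A' B' : Finset W) :
    ((A ∩ A') ∩ (B ∪ B')).card + ((A ∪ A') ∩ (B ∩ B')).card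
      ≤ (A ∩ B).card + (A' ∩ B').card := by
  rw [← Finset.card_union_add_card_inter, ← Finset.card_union_add_card_inter (A ∩ B)]
  apply Nat.add_le_add <;> apply Finset.card_le_card <;> intro v <;>
    simp only [Finset.mem_inter, Finset.mem_union] <;> tauto

/-- If every small side containing `Y` has order at least `n`, then the small sides of order at
most `n` containing `Y` are closed under unions. -/
lemma IsTangle.union_inter_mem {G : SimpleGraph V} {k : ℕ} {τ : Set (Finset V × Finset V)}
    (hτ : IsTangle G k τ) {Y : Finset V} {n : ℕ}
    (hn : ∀ p ∈ τ, Y ⊆ p.1 → n ≤ (p.1 ∩ p.2).card) {p q : Finset V × Finset V}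
    (hp : p ∈ τ) (hq : q ∈ τ) (hYp : Y ⊆ p.1) (hYq : Y ⊆ q.1)
    (hpn : (p.1 ∩ p.2).card ≤ n) (hqn : (q.1 ∩ q.2).card ≤ n) :
    (p.1 ∪ q.1, p.2 ∩ q.2) ∈ τ ∧ ((p.1 ∪ q.1) ∩ (p.2 ∩ q.2)).card ≤ n := by
  obtain ⟨hmem, horient, hcover⟩ := hτ
  obtain ⟨hsp, hpk⟩ := hmem p hp
  obtain ⟨hsq, -⟩ := hmem q hq
  have hsub := card_inter_union_add_card_union_inter_le p.1 p.2 q.1 q.2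
  have hpn' := hn p hp hYp
  have hle : ((p.1 ∪ q.1) ∩ (p.2 ∩ q.2)).card ≤ n := by
    by_contra! hlt
    by_cases hr : (p.2 ∪ q.2, p.1 ∩ q.1) ∈ τ
    · refine hcover p hp _ hr _ hr ⟨fun v => ?_, fun u v huv => ?_⟩
      · have := hsp.mem_or_mem v
        simp only [Finset.mem_union]
        tauto
      · have := hsp.adj_mem huv
        simp only [Finset.mem_union]
        tauto
    · have hr' := (horient _ _ (hsp.inter_union hsq) (by omega)).2 hr
      have := hn _ hr' (Finset.subset_inter hYp hYq)
      simp only at this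
      omega
  refine ⟨(horient _ _ (hsp.union_inter hsq) (by omega)).2 fun hr => ?_, hle⟩
  refine hcover p hp q hq _ hr ⟨fun v => ?_, fun u v huv => ?_⟩
  · have := hsp.mem_or_mem v
    have := hsq.mem_or_mem v
    simp only [Finset.mem_inter]
    tauto
  · have := hsp.adj_mem huv
    have := hsq.adj_mem huv
    simp only [Finset.mem_inter]
    tauto

/-- If every small side containing `Y` has order at least `n`, then some small side contains all
small sides of order at most `n` containing `Y`. -/
lemma IsTangle.exists_greatest {G : SimpleGraph V} {k : ℕ} {τ : Set (Finset V × Finset V)}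
    (hτ : IsTangle G k τ) (hne : τ.Nonempty) {Y : Finset V} {n : ℕ}
    (hn : ∀ p ∈ τ, Y ⊆ p.1 → n ≤ (p.1 ∩ p.2).card) :
    ∃ q ∈ τ, ∀ p ∈ τ, Y ⊆ p.1 → (p.1 ∩ p.2).card ≤ n → p.1 ⊆ q.1 := by
  let S : Set (Finset V × Finset V) := {p | p ∈ τ ∧ Y ⊆ p.1 ∧ (p.1 ∩ p.2).card ≤ n}
  rcases S.eq_empty_or_nonempty with hS | hS
  · obtain ⟨q, hq⟩ := hne
    exact ⟨q, hq, fun p hp hY hpn => absurd (show p ∈ S from ⟨hp, hY, hpn⟩) (by simp [hS])⟩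
  · obtain ⟨q, ⟨hq, hYq, hqn⟩, hmax⟩ :=
      S.exists_max_image (fun p => p.1.card) (Set.toFinite S) hS
    refine ⟨q, hq, fun p hp hYp hpn => ?_⟩
    obtain ⟨hmem, hle⟩ := hτ.union_inter_mem hn hq hp hYq hYp hqn hpn
    have hcard := hmax _ ⟨hmem, hYq.trans Finset.subset_union_left, hle⟩
    have heq := Finset.eq_of_subset_of_card_le Finset.subset_union_left hcard
    rw [heq]
    exact Finset.subset_union_right

/-- If the small sides containing `Y₁`, `Y₂`, `Y₃` have orders at least `n₁`, `n₂`, `n₃`, then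
boundedly many vertices (coded as pairs `(v, v)`) and edges of `G` suffice to avoid every union of
three such small sides. -/
lemma IsTangle.exists_avoiding {G : SimpleGraph V} {k : ℕ} {τ : Set (Finset V × Finset V)}
    (hτ : IsTangle G k τ) (hne : τ.Nonempty) (n : ℕ) :
    ∀ (n₁ n₂ n₃ : ℕ) (Y₁ Y₂ Y₃ : Finset V), 3 * k ≤ n₁ + n₂ + n₃ + n →
      (∀ p ∈ τ, Y₁ ⊆ p.1 → n₁ ≤ (p.1 ∩ p.2).card) →
      (∀ p ∈ τ, Y₂ ⊆ p.1 → n₂ ≤ (p.1 ∩ p.2).card) →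
      (∀ p ∈ τ, Y₃ ⊆ p.1 → n₃ ≤ (p.1 ∩ p.2).card) →
      ∃ X : Finset (V × V), X.card ≤ 4 ^ n ∧ (∀ e ∈ X, e.1 = e.2 ∨ G.Adj e.1 e.2) ∧
        ∀ p₁ ∈ τ, ∀ p₂ ∈ τ, ∀ p₃ ∈ τ, Y₁ ⊆ p₁.1 → Y₂ ⊆ p₂.1 → Y₃ ⊆ p₃.1 →
          ∃ e ∈ X, ¬ ((e.1 ∈ p₁.1 ∧ e.2 ∈ p₁.1) ∨ (e.1 ∈ p₂.1 ∧ e.2 ∈ p₂.1) ∨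
            (e.1 ∈ p₃.1 ∧ e.2 ∈ p₃.1)) := by
  induction n with
  | zero =>
    intro n₁ n₂ n₃ Y₁ Y₂ Y₃ hk h₁ h₂ h₃
    refine ⟨∅, by simp, by simp, fun p₁ hp₁ p₂ hp₂ p₃ hp₃ hY₁ hY₂ hY₃ => ?_⟩
    have := h₁ p₁ hp₁ hY₁
    have := h₂ p₂ hp₂ hY₂
    have := h₃ p₃ hp₃ hY₃
    have := (hτ.1 p₁ hp₁).2
    have := (hτ.1 p₂ hp₂).2
    have := (hτ.1 p₃ hp₃).2
    omega
  | succ n ih =>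
    intro n₁ n₂ n₃ Y₁ Y₂ Y₃ hk h₁ h₂ h₃
    obtain ⟨q₁, hq₁, hmax₁⟩ := hτ.exists_greatest hne h₁
    obtain ⟨q₂, hq₂, hmax₂⟩ := hτ.exists_greatest hne h₂
    obtain ⟨q₃, hq₃, hmax₃⟩ := hτ.exists_greatest hne h₃
    obtain ⟨e, heG, he⟩ : ∃ e : V × V, (e.1 = e.2 ∨ G.Adj e.1 e.2) ∧
        ¬ ((e.1 ∈ q₁.1 ∧ e.2 ∈ q₁.1) ∨ (e.1 ∈ q₂.1 ∧ e.2 ∈ q₂.1) ∨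
          (e.1 ∈ q₃.1 ∧ e.2 ∈ q₃.1)) := by
      by_contra! hall
      refine hτ.2.2 q₁ hq₁ q₂ hq₂ q₃ hq₃ ⟨fun v => ?_, fun u v huv => hall (u, v) (.inr huv)⟩
      simpa using hall (v, v) (.inl rfl)
    have step : ∀ {m : ℕ} {Y : Finset V} {q : Finset V × Finset V},
        (∀ p ∈ τ, Y ⊆ p.1 → m ≤ (p.1 ∩ p.2).card) →
        (∀ p ∈ τ, Y ⊆ p.1 → (p.1 ∩ p.2).card ≤ m → p.1 ⊆ q.1) →
        ¬ (e.1 ∈ q.1 ∧ e.2 ∈ q.1) →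
        ∀ p ∈ τ, Y ∪ {e.1, e.2} ⊆ p.1 → m + 1 ≤ (p.1 ∩ p.2).card := by
      intro m Y q hm hmax heq p hp hY
      by_contra! hlt
      have hsub := hmax p hp (Finset.union_subset_left hY) (by omega)
      exact heq ⟨hsub (hY (by simp)), hsub (hY (by simp))⟩
    obtain ⟨X₁, hc₁, hG₁, hX₁⟩ := ih (n₁ + 1) n₂ n₃ (Y₁ ∪ {e.1, e.2}) Y₂ Y₃ (by omega)
      (step h₁ hmax₁ (by tauto)) h₂ h₃
    obtain ⟨X₂, hc₂, hG₂, hX₂⟩ := ih n₁ (n₂ + 1) n₃ Y₁ (Y₂ ∪ {e.1, e.2}) Y₃ (by omega)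
      h₁ (step h₂ hmax₂ (by tauto)) h₃
    obtain ⟨X₃, hc₃, hG₃, hX₃⟩ := ih n₁ n₂ (n₃ + 1) Y₁ Y₂ (Y₃ ∪ {e.1, e.2}) (by omega)
      h₁ h₂ (step h₃ hmax₃ (by tauto))
    have extend : ∀ {Y A : Finset V}, Y ⊆ A → e.1 ∈ A ∧ e.2 ∈ A → Y ∪ {e.1, e.2} ⊆ A := by
      intro Y A hY heA
      simp [Finset.insert_subset_iff, hY, heA]
    refine ⟨insert e (X₁ ∪ X₂ ∪ X₃), ?_, ?_, ?_⟩
    · have := Finset.card_insert_le e (X₁ ∪ X₂ ∪ X₃)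
      have := Finset.card_union_le (X₁ ∪ X₂) X₃
      have := Finset.card_union_le X₁ X₂
      have := Nat.one_le_pow n 4 (by norm_num)
      rw [pow_succ]
      omega
    · intro f hf
      simp only [Finset.mem_insert, Finset.mem_union] at hf
      rcases hf with rfl | (hf | hf) | hf
      exacts [heG, hG₁ f hf, hG₂ f hf, hG₃ f hf]
    · intro p₁ hp₁ p₂ hp₂ p₃ hp₃ hY₁ hY₂ hY₃
      by_cases hcov : (e.1 ∈ p₁.1 ∧ e.2 ∈ p₁.1) ∨ (e.1 ∈ p₂.1 ∧ e.2 ∈ p₂.1) ∨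
          (e.1 ∈ p₃.1 ∧ e.2 ∈ p₃.1)
      · rcases hcov with h | h | h
        · obtain ⟨f, hf, hfc⟩ := hX₁ p₁ hp₁ p₂ hp₂ p₃ hp₃ (extend hY₁ h) hY₂ hY₃
          exact ⟨f, by simp [hf], hfc⟩
        · obtain ⟨f, hf, hfc⟩ := hX₂ p₁ hp₁ p₂ hp₂ p₃ hp₃ hY₁ (extend hY₂ h) hY₃
          exact ⟨f, by simp [hf], hfc⟩
        · obtain ⟨f, hf, hfc⟩ := hX₃ p₁ hp₁ p₂ hp₂ p₃ hp₃ hY₁ hY₂ (extend hY₃ h)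
          exact ⟨f, by simp [hf], hfc⟩
      · exact ⟨e, by simp, hcov⟩

/-- The subgraph of `G` consisting of the edges of `G` among the pairs in `X` and of all vertices
in pairs in `X`. -/
def pairSubgraph {W : Type} (G : SimpleGraph W) (X : Finset (W × W)) : G.Subgraph where
  verts := {v | ∃ e ∈ X, v = e.1 ∨ v = e.2}
  Adj u v := G.Adj u v ∧ ((u, v) ∈ X ∨ (v, u) ∈ X)
  adj_sub h := h.1
  edge_vert := by
    rintro u v ⟨-, h | h⟩
    exacts [⟨_, h, .inl rfl⟩, ⟨_, h, .inr rfl⟩]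
  symm := ⟨fun _ _ h => ⟨h.1.symm, h.2.symm⟩⟩

lemma ncard_verts_pairSubgraph_le {W : Type} [DecidableEq W] (G : SimpleGraph W)
    (X : Finset (W × W)) :
    (pairSubgraph G X).verts.ncard ≤ 2 * X.card := by
  have hsub : (pairSubgraph G X).verts ⊆ ↑(X.image Prod.fst ∪ X.image Prod.snd) := by
    rintro v ⟨e, he, rfl | rfl⟩
    · exact Finset.mem_union_left _ (Finset.mem_image_of_mem _ he)
    · exact Finset.mem_union_right _ (Finset.mem_image_of_mem _ he)
  have hle := Set.ncard_le_ncard hsub (Finset.finite_toSet _)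
  rw [Set.ncard_coe_finset] at hle
  have := Finset.card_union_le (X.image Prod.fst) (X.image Prod.snd)
  have := Finset.card_image_le (s := X) (f := Prod.fst)
  have := Finset.card_image_le (s := X) (f := Prod.snd)
  omega

lemma ncard_edgeSet_pairSubgraph_le {W : Type} [DecidableEq W] (G : SimpleGraph W)
    (X : Finset (W × W)) :
    (pairSubgraph G X).edgeSet.ncard ≤ X.card := by
  have hsub : (pairSubgraph G X).edgeSet ⊆ ↑(X.image fun e => s(e.1, e.2)) := by
    intro e he
    induction e with
    | _ u v =>
      rw [Finset.coe_image]
      rcases (SimpleGraph.Subgraph.mem_edgeSet.1 he).2 with h | h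
      exacts [⟨_, h, rfl⟩, ⟨_, h, Sym2.eq_swap⟩]
  have hle := Set.ncard_le_ncard hsub (Finset.finite_toSet _)
  rw [Set.ncard_coe_finset] at hle
  exact hle.trans Finset.card_image_le

/-- For every `k ≥ 1` there is an `M'` such that every `k`-tangle in any graph `G` is
witnessed by a subgraph of `G` with at most `M'` vertices and at most `M'` edges. -/
theorem stmt19 (k : ℕ) (hk : 1 ≤ k) :
    ∃ M' : ℕ, ∀ (V : Type) [Fintype V] [DecidableEq V] (G : SimpleGraph V)
      (τ : Set (Finset V × Finset V)), IsTangle G k τ →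
      ∃ H : G.Subgraph, H.verts.ncard ≤ M' ∧ H.edgeSet.ncard ≤ M' ∧ Witnesses G H τ := by
  refine ⟨2 * 4 ^ (3 * k), fun V _ _ G τ hτ => ?_⟩
  rcases τ.eq_empty_or_nonempty with rfl | hne
  · exact ⟨⊥, by simp, by simp, by simp [Witnesses]⟩
  obtain ⟨X, hcard, hG, hX⟩ := hτ.exists_avoiding hne (3 * k) 0 0 0 ∅ ∅ ∅ (by omega)
    (by simp) (by simp) (by simp)
  have hverts := ncard_verts_pairSubgraph_le G X
  have hedges := ncard_edgeSet_pairSubgraph_le G X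
  refine ⟨pairSubgraph G X, by omega, by omega, ?_⟩
  rintro p₁ hp₁ p₂ hp₂ p₃ hp₃ ⟨hv, hadj⟩
  obtain ⟨⟨u, v⟩, he, hcov⟩ := hX p₁ hp₁ p₂ hp₂ p₃ hp₃ (by simp) (by simp) (by simp)
  rcases hG _ he with heq | huv
  · obtain rfl : u = v := heq
    exact hcov (by simpa using hv u ⟨_, he, .inl rfl⟩)
  · exact hcov (hadj u v ⟨huv, .inl he⟩)
end
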